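/- Let x > 0 be a real number with x ≠ 1. Then there exists a constant C_x such that for all T ≥ 2, |Σ_ρ x^ρ| ≤ C_x · T, where the sum runs over the nontrivial zeros ρ of ζ with 0 < Im ρ ≤ T, each zero counted according to its multiplicity (the order of vanishing of ζ at ρ), and x^ρ = exp(ρ log x). -/

import Mathlib

open Complex Filter

/-- Logarithmic derivative bound for a zero-free function whose growth relative to the
centre of a disk is controlled (Borel–Carathéodory and Cauchy). -/
theorem norm_logDeriv_le_of_zeroFree {g : ℂ → ℂ} {c : ℂ} {r R L : ℝ} (hr : 0 < r) (hrR : r < R)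
    (hL : 0 < L) (hg : DifferentiableOn ℂ g (Metric.ball c R))
    (h0 : ∀ s ∈ Metric.ball c R, g s ≠ 0)
    (hb : ∀ s ∈ Metric.ball c R, ‖g s‖ ≤ Real.exp L * ‖g c‖) :
    ∀ s ∈ Metric.closedBall c r, ‖logDeriv g s‖ ≤ (8 * R / (R - r) ^ 2) * L := by
  have hR : 0 < R := hr.trans hrR
  have hcR : c ∈ Metric.ball c R := Metric.mem_ball_self hR
  have hld : DifferentiableOn ℂ (logDeriv g) (Metric.ball c R) := fun z hz => by
    have := (hg.analyticAt (Metric.isOpen_ball.mem_nhds hz))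
    exact (this.deriv.differentiableAt.div this.differentiableAt (h0 z hz)).differentiableWithinAt
  obtain ⟨G, hG⟩ := hld.isExactOn_ball
  have hconst : ∀ z ∈ Metric.ball c R, g z = g c * Complex.exp (G z - G c) := by
    have key : ∀ z ∈ Metric.ball c R,
        HasDerivAt (fun z => g z * Complex.exp (-(G z - G c))) 0 z := by
      intro z hz
      have h1 := (hg.differentiableAt (Metric.isOpen_ball.mem_nhds hz)).hasDerivAt
      have h2 := (((hG z hz).sub_const (G c)).neg).cexp
      refine (h1.mul h2).congr_deriv ?_
      have := h0 z hz
      simp only [logDeriv_apply, Pi.neg_apply]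
      field_simp
      ring
    intro z hz
    have hc := (convex_ball c R).is_const_of_fderivWithin_eq_zero (𝕜 := ℂ)
      (f := fun z => g z * Complex.exp (-(G z - G c)))
      (fun z hz => (key z hz).differentiableAt.differentiableWithinAt)
      (fun z hz => by
        rw [fderivWithin_of_isOpen Metric.isOpen_ball hz, (key z hz).hasFDerivAt.fderiv]
        ext; simp) hz hcR
    simp only [sub_self, neg_zero, Complex.exp_zero, mul_one] at hc
    rw [← hc, mul_assoc, ← Complex.exp_add]
    simp
  set F : ℂ → ℂ := fun w => G (c + w) - G c with hF
  have hmem : ∀ w ∈ Metric.ball (0 : ℂ) R, c + w ∈ Metric.ball c R := fun w hw => by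
    simpa [Metric.mem_ball, dist_eq_norm] using hw
  have hFd : ∀ w ∈ Metric.ball (0 : ℂ) R, HasDerivAt F (logDeriv g (c + w)) w := fun w hw => by
    have := (hG _ (hmem w hw)).comp_const_add c w
    exact this.sub_const _
  have hre : Set.MapsTo F (Metric.ball 0 R) {z | z.re ≤ L} := fun w hw => by
    have h1 := hb _ (hmem w hw)
    rw [hconst _ (hmem w hw), norm_mul, mul_comm, Complex.norm_exp] at h1
    have := le_of_mul_le_mul_right h1 (norm_pos_iff.mpr (h0 c hcR))
    exact Real.exp_le_exp.mp this
  have hFb : ∀ w ∈ Metric.ball (0 : ℂ) R, ‖F w‖ ≤ 2 * L * ‖w‖ / (R - ‖w‖) := fun w hw =>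
    borelCaratheodory_zero hL (fun z hz => (hFd z hz).differentiableAt.differentiableWithinAt)
      hre hR hw (by simp [hF])
  intro s hs
  have hs' : ‖s - c‖ ≤ r := by simpa [dist_eq_norm] using hs
  set δ := (R - r) / 2 with hδ
  have hδ0 : 0 < δ := by rw [hδ]; linarith
  have hsub : ∀ z ∈ Metric.closedBall (s - c) δ, ‖z‖ ≤ r + δ := fun z hz => by
    have h1 : ‖z - (s - c)‖ ≤ δ := by simpa [dist_eq_norm] using hz
    calc ‖z‖ = ‖(z - (s - c)) + (s - c)‖ := by ring_nf
      _ ≤ _ := (norm_add_le _ _).trans (by linarith)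
  have hin : ∀ z ∈ Metric.closedBall (s - c) δ, z ∈ Metric.ball (0 : ℂ) R := fun z hz => by
    have := hsub z hz
    simp only [Metric.mem_ball, dist_zero_right]
    linarith
  have hder := norm_deriv_le_of_forall_mem_sphere_norm_le (f := F) (c := s - c) (R := δ)
    (C := 2 * L * R / δ) hδ0
    (DifferentiableOn.diffContOnCl_ball (U := Metric.closedBall (s - c) δ)
      (fun z hz => (hFd z (hin z hz)).differentiableAt.differentiableWithinAt) subset_rfl)
    (fun z hz => by
      have hz' := Metric.sphere_subset_closedBall hz
      refine (hFb z (hin z hz')).trans ?_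
      have := hsub z hz'
      gcongr <;> linarith)
  have h2 := (hFd (s - c) (hin _ (Metric.mem_closedBall_self hδ0.le))).deriv
  rw [h2] at hder
  simp only [add_sub_cancel] at hder
  refine hder.trans (le_of_eq ?_)
  rw [hδ]
  have : R - r ≠ 0 := by linarith
  field_simp
  ring

/-- An entire function with prescribed orders of vanishing on a finite set factors globally. -/
theorem exists_entire_factor (S : Finset ℂ) (m : ℂ → ℕ) {f : ℂ → ℂ} (hf : Differentiable ℂ f)
    (h : ∀ ρ ∈ S, ∃ g : ℂ → ℂ, AnalyticAt ℂ g ρ ∧ g ρ ≠ 0 ∧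
      ∀ᶠ w in nhds ρ, f w = (w - ρ) ^ m ρ * g w) :
    ∃ g : ℂ → ℂ, Differentiable ℂ g ∧ (∀ ρ ∈ S, g ρ ≠ 0) ∧
      ∀ w, f w = (∏ ρ ∈ S, (w - ρ) ^ m ρ) * g w := by
  classical
  induction S using Finset.induction_on generalizing f with
  | empty => exact ⟨f, hf, by simp, by simp⟩
  | insert a S ha ih =>
    obtain ⟨g₀, hg₀, hg₀a, hg₀e⟩ := h a (Finset.mem_insert_self a S)
    set g₁ : ℂ → ℂ := fun w => if w = a then g₀ a else f w / (w - a) ^ m a with hg₁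
    have hne : ∀ w, w ≠ a → g₁ w = f w / (w - a) ^ m a := fun w hw => by simp [hg₁, hw]
    have hfg : ∀ w, f w = (w - a) ^ m a * g₁ w := by
      intro w
      rcases eq_or_ne w a with rfl | hw
      · rw [hg₀e.self_of_nhds]; simp [hg₁]
      · rw [hne w hw, mul_div_cancel₀]
        exact pow_ne_zero _ (sub_ne_zero.mpr hw)
    have hg₁d : Differentiable ℂ g₁ := by
      intro z
      rcases eq_or_ne z a with rfl | hz
      · refine hg₀.differentiableAt.congr_of_eventuallyEq ?_
        filter_upwards [hg₀e] with w hw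
        rcases eq_or_ne w z with rfl | hwz
        · simp [hg₁]
        · rw [hne w hwz, hw, mul_div_cancel_left₀]
          exact pow_ne_zero _ (sub_ne_zero.mpr hwz)
      · have : DifferentiableAt ℂ (fun w => f w / (w - a) ^ m a) z :=
          (hf z).div (by fun_prop) (pow_ne_zero _ (sub_ne_zero.mpr hz))
        refine this.congr_of_eventuallyEq ?_
        filter_upwards [isOpen_ne.mem_nhds hz] with w hw using hne w hw
    obtain ⟨g, hgd, hgS, hge⟩ := ih hg₁d (fun ρ hρ => by
      obtain ⟨k, hk, hk0, hke⟩ := h ρ (Finset.mem_insert_of_mem hρ)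
      have hρa : ρ ≠ a := fun e => ha (e ▸ hρ)
      have hpow : (ρ - a) ^ m a ≠ 0 := pow_ne_zero _ (sub_ne_zero.mpr hρa)
      refine ⟨fun w => k w / (w - a) ^ m a, hk.div (by fun_prop) hpow, div_ne_zero hk0 hpow, ?_⟩
      filter_upwards [hke, isOpen_ne.mem_nhds hρa] with w hw hwa
      rw [hne w hwa, hw, mul_div_assoc])
    refine ⟨g, hgd, fun ρ hρ => ?_, fun w => ?_⟩
    · rcases Finset.mem_insert.mp hρ with rfl | hρ
      · have h1 := hge ρ
        have h2 : g₁ ρ = g₀ ρ := by simp [hg₁]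
        intro h0
        rw [h2, h0, mul_zero] at h1
        exact hg₀a h1
      · exact hgS ρ hρ
    · rw [Finset.prod_insert ha, hfg w, hge w, mul_assoc]

/-- The zeros of a nonzero entire function in a compact set form a finite set. -/
theorem finite_zeros_of_entire {f : ℂ → ℂ} (hf : Differentiable ℂ f) {c : ℂ} (hc : f c ≠ 0)
    {K : Set ℂ} (hK : IsCompact K) : {z ∈ K | f z = 0}.Finite := by
  by_contra hinf
  obtain ⟨p, -, hp⟩ := Set.Infinite.exists_accPt_of_subset_isCompact hinf hK
    (fun z hz => hz.1)
  have hfr : ∃ᶠ z in nhdsWithin p {p}ᶜ, f z = 0 :=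
    (accPt_iff_frequently_nhdsNE.mp hp).mono fun z hz => hz.2
  have han : AnalyticOnNhd ℂ f Set.univ := fun z _ => hf.analyticAt z
  exact hc (han.eqOn_zero_of_preconnected_of_frequently_eq_zero isPreconnected_univ
    (Set.mem_univ p) hfr (Set.mem_univ c))

/-- A nonzero entire function vanishes to finite order at each point. -/
theorem exists_order_of_entire {f : ℂ → ℂ} (hf : Differentiable ℂ f) {c : ℂ} (hc : f c ≠ 0)
    (ρ : ℂ) : ∃ n : ℕ, ∃ g : ℂ → ℂ, AnalyticAt ℂ g ρ ∧ g ρ ≠ 0 ∧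
      ∀ᶠ w in nhds ρ, f w = (w - ρ) ^ n * g w := by
  refine (hf.analyticAt ρ).exists_eventuallyEq_pow_smul_nonzero_iff.mpr fun h => hc ?_
  have han : AnalyticOnNhd ℂ f Set.univ := fun z _ => hf.analyticAt z
  exact han.eqOn_zero_of_preconnected_of_eventuallyEq_zero isPreconnected_univ
    (Set.mem_univ ρ) h (Set.mem_univ c)

/-- Extraction of the zeros of an entire function in a disk, with quantitative control of the
number of zeros and of the logarithmic derivative of the zero-free factor. -/
theorem exists_local_factorization {f : ℂ → ℂ} (hf : Differentiable ℂ f) {c : ℂ} {r R L : ℝ}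
    (hr : 0 < r) (hrR : r < R) (hL : 0 < L) (hc : f c ≠ 0)
    (hb : ∀ s ∈ Metric.closedBall c (3 * R), ‖f s‖ ≤ Real.exp L * ‖f c‖) :
    ∃ (S : Finset ℂ) (m : ℂ → ℕ) (g : ℂ → ℂ), Differentiable ℂ g ∧
      (∀ ρ ∈ S, f ρ = 0) ∧ (∀ ρ ∈ S, ρ ∈ Metric.closedBall c R) ∧
      (∀ w, f w = (∏ ρ ∈ S, (w - ρ) ^ m ρ) * g w) ∧
      (∀ s ∈ Metric.closedBall c R, g s ≠ 0) ∧
      (∑ ρ ∈ S, (m ρ : ℝ)) ≤ L / Real.log 2 ∧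
      ∀ s ∈ Metric.closedBall c r, ‖logDeriv g s‖ ≤ (8 * R / (R - r) ^ 2) * L := by
  have hR : 0 < R := hr.trans hrR
  have hfin := finite_zeros_of_entire hf hc (isCompact_closedBall c R)
  set S := hfin.toFinset with hS
  have hSm : ∀ ρ, ρ ∈ S ↔ ρ ∈ Metric.closedBall c R ∧ f ρ = 0 := fun ρ => by simp [hS]
  choose m k hk using exists_order_of_entire hf hc
  obtain ⟨g, hgd, hgS, hge⟩ := exists_entire_factor S m hf (fun ρ _ => ⟨k ρ, hk ρ⟩)
  set N := ∑ ρ ∈ S, m ρ with hN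
  have hgc : 0 < ‖g c‖ := by
    refine norm_pos_iff.mpr fun h0 => hc ?_
    rw [hge c, h0, mul_zero]
  have hsph : ∀ s ∈ Metric.sphere c (3 * R), ‖g s‖ ≤ Real.exp L * ‖g c‖ / 2 ^ N := by
    intro s hs
    have h1 := hb s (Metric.sphere_subset_closedBall hs)
    have hs' : ‖s - c‖ = 3 * R := by simpa [dist_eq_norm] using hs
    rw [hge s, hge c, norm_mul, norm_mul, norm_prod, norm_prod] at h1
    have h2 : (2 * R) ^ N ≤ ∏ ρ ∈ S, ‖(s - ρ) ^ m ρ‖ := by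
      rw [hN, ← Finset.prod_pow_eq_pow_sum]
      refine Finset.prod_le_prod (fun _ _ => by positivity) fun ρ hρ => ?_
      rw [norm_pow]
      have h3 : ‖ρ - c‖ ≤ R := by simpa [dist_eq_norm] using ((hSm ρ).mp hρ).1
      have h4 : ‖s - c‖ ≤ ‖s - ρ‖ + ‖ρ - c‖ := norm_sub_le_norm_sub_add_norm_sub _ _ _
      gcongr
      linarith
    have h3 : ∏ ρ ∈ S, ‖(c - ρ) ^ m ρ‖ ≤ R ^ N := by
      rw [hN, ← Finset.prod_pow_eq_pow_sum]
      refine Finset.prod_le_prod (fun _ _ => by positivity) fun ρ hρ => ?_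
      rw [norm_pow]
      have h3 : ‖ρ - c‖ ≤ R := by simpa [dist_eq_norm] using ((hSm ρ).mp hρ).1
      rw [norm_sub_rev] at h3
      gcongr
    have h4 : (2 * R) ^ N * ‖g s‖ ≤ Real.exp L * (R ^ N * ‖g c‖) :=
      (mul_le_mul_of_nonneg_right h2 (norm_nonneg _)).trans (h1.trans (by gcongr))
    rw [le_div_iff₀ (by positivity)]
    rw [mul_pow] at h4
    have : R ^ N * (‖g s‖ * 2 ^ N) ≤ R ^ N * (Real.exp L * ‖g c‖) := by linarith
    exact le_of_mul_le_mul_left this (by positivity)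
  have hall : ∀ s ∈ Metric.closedBall c (3 * R), ‖g s‖ ≤ Real.exp L * ‖g c‖ / 2 ^ N := by
    intro s hs
    refine Complex.norm_le_of_forall_mem_frontier_norm_le (U := Metric.ball c (3 * R))
      Metric.isBounded_ball (hgd.diffContOnCl) ?_ ?_
    · rw [frontier_ball c (by positivity)]; exact hsph
    · rwa [closure_ball c (by positivity)]
  have hgR : ∀ s ∈ Metric.closedBall c R, g s ≠ 0 := by
    intro s hs h0
    have : s ∈ S := (hSm s).mpr ⟨hs, by rw [hge s, h0, mul_zero]⟩
    exact hgS s this h0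
  refine ⟨S, m, g, hgd, fun ρ hρ => ((hSm ρ).mp hρ).2, fun ρ hρ => ((hSm ρ).mp hρ).1, hge, hgR,
    ?_, ?_⟩
  · have h1 := hall c (Metric.mem_closedBall_self (by positivity))
    rw [le_div_iff₀ (by positivity), mul_comm] at h1
    have h2 := Real.log_le_log (by positivity) (le_of_mul_le_mul_right h1 hgc)
    rw [Real.log_exp, Real.log_pow] at h2
    rw [le_div_iff₀ (Real.log_pos one_lt_two)]
    simpa [hN] using h2
  · refine norm_logDeriv_le_of_zeroFree hr hrR hL hgd.differentiableOn
      (fun s hs => hgR s (Metric.ball_subset_closedBall hs)) fun s hs => ?_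
    refine (hall s (Metric.closedBall_subset_closedBall (by linarith)
      (Metric.ball_subset_closedBall hs))).trans ?_
    exact div_le_self (by positivity) (one_le_pow₀ one_le_two)

/-- The integral of `f` along the positively oriented boundary of `[a, b] × [c, d]`. -/
noncomputable def rectIntegral (f : ℂ → ℂ) (a b c d : ℝ) : ℂ :=
  (∫ x : ℝ in a..b, f (x + c * I)) - (∫ x : ℝ in a..b, f (x + d * I))
    + I * (∫ y : ℝ in c..d, f (b + y * I)) - I * (∫ y : ℝ in c..d, f (a + y * I))

/-- The boundary of the rectangle `[a, b] × [c, d]`. -/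
def rectBoundary (a b c d : ℝ) : Set ℂ :=
  {s | s.re ∈ Set.Icc a b ∧ s.im ∈ Set.Icc c d ∧ (s.re = a ∨ s.re = b ∨ s.im = c ∨ s.im = d)}

section Rectangle

variable {a b c d : ℝ}

theorem mem_rectBoundary_bottom (hcd : c ≤ d) {x : ℝ} (hx : x ∈ Set.Icc a b) :
    (x + c * I : ℂ) ∈ rectBoundary a b c d := by
  simp [rectBoundary, hcd, hx.1, hx.2]

theorem mem_rectBoundary_top (hcd : c ≤ d) {x : ℝ} (hx : x ∈ Set.Icc a b) :
    (x + d * I : ℂ) ∈ rectBoundary a b c d := by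
  simp [rectBoundary, hcd, hx.1, hx.2]

theorem mem_rectBoundary_right (hab : a ≤ b) {y : ℝ} (hy : y ∈ Set.Icc c d) :
    (b + y * I : ℂ) ∈ rectBoundary a b c d := by
  simp [rectBoundary, hab, hy.1, hy.2]

theorem mem_rectBoundary_left (hab : a ≤ b) {y : ℝ} (hy : y ∈ Set.Icc c d) :
    (a + y * I : ℂ) ∈ rectBoundary a b c d := by
  simp [rectBoundary, hab, hy.1, hy.2]

theorem rectIntegral_congr (hab : a ≤ b) (hcd : c ≤ d) {f g : ℂ → ℂ}
    (h : ∀ s ∈ rectBoundary a b c d, f s = g s) :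
    rectIntegral f a b c d = rectIntegral g a b c d := by
  unfold rectIntegral
  congr 1; congr 1; congr 1
  · exact intervalIntegral.integral_congr fun x hx => h _
      (mem_rectBoundary_bottom hcd (by rwa [Set.uIcc_of_le hab] at hx))
  · exact intervalIntegral.integral_congr fun x hx => h _
      (mem_rectBoundary_top hcd (by rwa [Set.uIcc_of_le hab] at hx))
  · exact congrArg _ <| intervalIntegral.integral_congr fun x hx => h _
      (mem_rectBoundary_right hab (by rwa [Set.uIcc_of_le hcd] at hx))
  · exact congrArg _ <| intervalIntegral.integral_congr fun x hx => h _
      (mem_rectBoundary_left hab (by rwa [Set.uIcc_of_le hcd] at hx))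

theorem intervalIntegrable_horizontal (hab : a ≤ b) {f : ℂ → ℂ} {y : ℝ} {K : Set ℂ}
    (hf : ContinuousOn f K) (h : ∀ x ∈ Set.Icc a b, (x + y * I : ℂ) ∈ K) :
    IntervalIntegrable (fun x : ℝ => f (x + y * I)) MeasureTheory.volume a b := by
  apply ContinuousOn.intervalIntegrable
  rw [Set.uIcc_of_le hab]
  exact hf.comp (by fun_prop) h

theorem intervalIntegrable_vertical (hcd : c ≤ d) {f : ℂ → ℂ} {x : ℝ} {K : Set ℂ}
    (hf : ContinuousOn f K) (h : ∀ y ∈ Set.Icc c d, (x + y * I : ℂ) ∈ K) :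
    IntervalIntegrable (fun y : ℝ => f (x + y * I)) MeasureTheory.volume c d := by
  apply ContinuousOn.intervalIntegrable
  rw [Set.uIcc_of_le hcd]
  exact hf.comp (by fun_prop) h

theorem rectIntegral_add (hab : a ≤ b) (hcd : c ≤ d) {f g : ℂ → ℂ}
    (hf : ContinuousOn f (rectBoundary a b c d)) (hg : ContinuousOn g (rectBoundary a b c d)) :
    rectIntegral (fun s => f s + g s) a b c d
      = rectIntegral f a b c d + rectIntegral g a b c d := by
  unfold rectIntegral
  rw [intervalIntegral.integral_add
      (intervalIntegrable_horizontal hab hf fun x hx => mem_rectBoundary_bottom hcd hx)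
      (intervalIntegrable_horizontal hab hg fun x hx => mem_rectBoundary_bottom hcd hx),
    intervalIntegral.integral_add
      (intervalIntegrable_horizontal hab hf fun x hx => mem_rectBoundary_top hcd hx)
      (intervalIntegrable_horizontal hab hg fun x hx => mem_rectBoundary_top hcd hx),
    intervalIntegral.integral_add
      (intervalIntegrable_vertical hcd hf fun x hx => mem_rectBoundary_right hab hx)
      (intervalIntegrable_vertical hcd hg fun x hx => mem_rectBoundary_right hab hx),
    intervalIntegral.integral_add
      (intervalIntegrable_vertical hcd hf fun x hx => mem_rectBoundary_left hab hx)
      (intervalIntegrable_vertical hcd hg fun x hx => mem_rectBoundary_left hab hx)]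
  ring

theorem rectIntegral_const_mul (k : ℂ) (f : ℂ → ℂ) :
    rectIntegral (fun s => k * f s) a b c d = k * rectIntegral f a b c d := by
  unfold rectIntegral
  simp only [intervalIntegral.integral_const_mul]
  ring

theorem rectIntegral_sum (hab : a ≤ b) (hcd : c ≤ d) (S : Finset ℂ) {f : ℂ → ℂ → ℂ}
    (hf : ∀ ρ ∈ S, ContinuousOn (f ρ) (rectBoundary a b c d)) :
    rectIntegral (fun s => ∑ ρ ∈ S, f ρ s) a b c d = ∑ ρ ∈ S, rectIntegral (f ρ) a b c d := by
  classical
  induction S using Finset.induction_on with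
  | empty => simp [rectIntegral]
  | insert ρ S hρ ih =>
    simp only [Finset.sum_insert hρ]
    rw [rectIntegral_add hab hcd (hf _ (by simp))
      (continuousOn_finsetSum _ fun i hi => hf i (by simp [hi])),
      ih fun i hi => hf i (by simp [hi])]

theorem rectIntegral_eq_zero (hab : a ≤ b) (hcd : c ≤ d) {f : ℂ → ℂ}
    (hf : DifferentiableOn ℂ f (Set.Icc a b ×ℂ Set.Icc c d)) :
    rectIntegral f a b c d = 0 := by
  have h := Complex.integral_boundary_rect_eq_zero_of_differentiableOn f (a + c * I) (b + d * I)
    (by simpa [Set.uIcc_of_le hab, Set.uIcc_of_le hcd] using hf)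
  simpa [rectIntegral] using h

theorem integral_inv_line {k p q : ℂ} {α β : ℝ}
    (h : ∀ x ∈ Set.uIcc α β, k * (p + x * q) ∈ slitPlane) :
    ∫ x : ℝ in α..β, q / (p + x * q)
      = Complex.log (k * (p + β * q)) - Complex.log (k * (p + α * q)) := by
  have hk : k ≠ 0 := by
    rintro rfl
    exact slitPlane_ne_zero (h α Set.left_mem_uIcc) (by simp)
  have hne : ∀ x ∈ Set.uIcc α β, p + (x : ℂ) * q ≠ 0 := fun x hx h0 =>
    slitPlane_ne_zero (h x hx) (by simp [h0])
  refine intervalIntegral.integral_eq_sub_of_hasDerivAt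
    (f := fun x : ℝ => Complex.log (k * (p + x * q))) (fun x hx => ?_) ?_
  · have h1 : HasDerivAt (fun x : ℝ => k * (p + x * q)) (k * (1 * q)) x :=
      ((Complex.ofRealCLM.hasDerivAt.mul_const q).const_add p).const_mul k
    have h2 := h1.clog_real (h x hx)
    refine h2.congr_deriv ?_
    have := hne x hx
    field_simp
  · apply ContinuousOn.intervalIntegrable
    exact ContinuousOn.div (by fun_prop) (by fun_prop) hne

theorem log_I_mul {w : ℂ} (h1 : 0 < w.re) (h2 : w.im < 0) :
    Complex.log (I * w) = Complex.log w + Real.pi / 2 * I := by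
  have hw : w ≠ 0 := by rintro rfl; simp at h1
  have ha : w.arg < 0 := Complex.arg_neg_iff.2 h2
  rw [Complex.log_mul I_ne_zero hw, Complex.log_I]
  · ring
  · rw [Complex.arg_I]
    have := Complex.neg_pi_lt_arg w
    have h3 : -(Real.pi / 2) < w.arg := by
      have := Complex.abs_arg_lt_pi_div_two_iff.2 (Or.inl h1)
      exact (abs_lt.1 this).1
    constructor <;> linarith [Real.pi_pos]

theorem rectIntegral_inv {ρ : ℂ} (h1 : a < ρ.re) (h2 : ρ.re < b) (h3 : c < ρ.im)
    (h4 : ρ.im < d) : rectIntegral (fun s => 1 / (s - ρ)) a b c d = 2 * Real.pi * I := by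
  have hab : a ≤ b := by linarith
  have hcd : c ≤ d := by linarith
  have e1 : ∫ x : ℝ in a..b, 1 / ((x + c * I : ℂ) - ρ)
      = Complex.log (I * (b + c * I - ρ)) - Complex.log (I * (a + c * I - ρ)) := by
    have := integral_inv_line (k := I) (p := c * I - ρ) (q := 1) (α := a) (β := b)
      (fun x hx => Or.inl (by simp; linarith))
    convert this using 4 <;> ring_nf
  have e2 : ∫ x : ℝ in a..b, 1 / ((x + d * I : ℂ) - ρ)
      = Complex.log (-I * (b + d * I - ρ)) - Complex.log (-I * (a + d * I - ρ)) := by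
    have := integral_inv_line (k := -I) (p := d * I - ρ) (q := 1) (α := a) (β := b)
      (fun x hx => Or.inl (by simp; linarith))
    convert this using 4 <;> ring_nf
  have e3 : I * ∫ y : ℝ in c..d, 1 / ((b + y * I : ℂ) - ρ)
      = Complex.log (b + d * I - ρ) - Complex.log (b + c * I - ρ) := by
    have := integral_inv_line (k := 1) (p := b - ρ) (q := I) (α := c) (β := d)
      (fun x hx => Or.inl (by simp; linarith))
    rw [← intervalIntegral.integral_const_mul]
    exact (intervalIntegral.integral_congr fun y _ => by ring_nf).trans (this.trans (by ring_nf))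
  have e4 : I * ∫ y : ℝ in c..d, 1 / ((a + y * I : ℂ) - ρ)
      = Complex.log (-(a + d * I - ρ)) - Complex.log (-(a + c * I - ρ)) := by
    have := integral_inv_line (k := -1) (p := a - ρ) (q := I) (α := c) (β := d)
      (fun x hx => Or.inl (by simp; linarith))
    rw [← intervalIntegral.integral_const_mul]
    exact (intervalIntegral.integral_congr fun y _ => by ring_nf).trans (this.trans (by ring_nf))
  have f1 := log_I_mul (w := b + c * I - ρ) (by simp; linarith) (by simp; linarith)
  have f2 := log_I_mul (w := -I * (b + d * I - ρ)) (by simp; linarith) (by simp; linarith)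
  have f3 := log_I_mul (w := -(a + d * I - ρ)) (by simp; linarith) (by simp; linarith)
  have f4 := log_I_mul (w := I * (a + c * I - ρ)) (by simp; linarith) (by simp; linarith)
  have g2 : I * (-I * (b + d * I - ρ)) = b + d * I - ρ := by
    linear_combination (-(b + d * I - ρ)) * I_mul_I
  have g3 : I * (-(a + d * I - ρ)) = -I * (a + d * I - ρ) := by ring
  have g4 : I * (I * (a + c * I - ρ)) = -(a + c * I - ρ) := by
    linear_combination (a + c * I - ρ) * I_mul_I
  rw [g2] at f2
  rw [g3] at f3
  rw [g4] at f4
  rw [rectIntegral, e1, e2, e3, e4, f1, f2, f3, f4]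
  ring

theorem ne_of_mem_rectBoundary {ρ s : ℂ} (h1 : a < ρ.re) (h2 : ρ.re < b) (h3 : c < ρ.im)
    (h4 : ρ.im < d) (hs : s ∈ rectBoundary a b c d) : s - ρ ≠ 0 := by
  intro h
  obtain rfl : s = ρ := sub_eq_zero.1 h
  rcases hs.2.2 with h | h | h | h <;> linarith

/-- The logarithmic derivative of a polynomial times a zero-free function. -/
theorem logDeriv_eq_sum_add_logDeriv {f g : ℂ → ℂ} {s : ℂ} (hg : Differentiable ℂ g)
    (S : Finset ℂ) (m : ℂ → ℕ) (hfg : ∀ w, f w = (∏ ρ ∈ S, (w - ρ) ^ m ρ) * g w)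
    (hne : ∀ ρ ∈ S, s - ρ ≠ 0) (hg0 : g s ≠ 0) :
    logDeriv f s = (∑ ρ ∈ S, m ρ / (s - ρ)) + logDeriv g s := by
  have hf : f = fun w => (∏ ρ ∈ S, (w - ρ) ^ m ρ) * g w := funext hfg
  rw [hf, logDeriv_mul s (Finset.prod_ne_zero_iff.2 fun ρ hρ => pow_ne_zero _ (hne ρ hρ))
    hg0 (by fun_prop) (hg s), logDeriv_prod (f := fun ρ w => (w - ρ) ^ m ρ)
    (fun ρ hρ => pow_ne_zero _ (hne ρ hρ)) (fun ρ _ => by fun_prop)]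
  congr 1
  refine Finset.sum_congr rfl fun ρ _ => ?_
  rw [logDeriv_fun_pow (by fun_prop)]
  simp [logDeriv_apply, div_eq_mul_inv]

/-- The argument principle on a rectangle, weighted by an entire function. -/
theorem rectIntegral_mul_logDeriv (hab : a ≤ b) (hcd : c ≤ d) {F f g : ℂ → ℂ}
    (hF : Differentiable ℂ F) (hg : Differentiable ℂ g) (S : Finset ℂ) (m : ℂ → ℕ)
    (hS : ∀ ρ ∈ S, a < ρ.re ∧ ρ.re < b ∧ c < ρ.im ∧ ρ.im < d)
    (hfg : ∀ w, f w = (∏ ρ ∈ S, (w - ρ) ^ m ρ) * g w)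
    (hg0 : ∀ s ∈ Set.Icc a b ×ℂ Set.Icc c d, g s ≠ 0) :
    rectIntegral (fun s => F s * logDeriv f s) a b c d
      = 2 * Real.pi * I * ∑ ρ ∈ S, m ρ * F ρ := by
  have hsub : rectBoundary a b c d ⊆ Set.Icc a b ×ℂ Set.Icc c d := fun s hs => ⟨hs.1, hs.2.1⟩
  have hne : ∀ ρ ∈ S, ∀ s ∈ rectBoundary a b c d, s - ρ ≠ 0 := fun ρ hρ s hs =>
    ne_of_mem_rectBoundary (hS ρ hρ).1 (hS ρ hρ).2.1 (hS ρ hρ).2.2.1 (hS ρ hρ).2.2.2 hs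
  have hds : ∀ ρ, Differentiable ℂ (dslope F ρ) := fun ρ => by
    rw [← differentiableOn_univ, differentiableOn_dslope univ_mem, differentiableOn_univ]
    exact hF
  have hreg : DifferentiableOn ℂ (fun s => (∑ ρ ∈ S, m ρ * dslope F ρ s) + F s * logDeriv g s)
      (Set.Icc a b ×ℂ Set.Icc c d) := by
    refine DifferentiableOn.add ?_ ?_
    · exact (Differentiable.fun_sum fun ρ _ => (hds ρ).const_mul _).differentiableOn
    · refine hF.differentiableOn.mul ?_
      refine DifferentiableOn.div ?_ hg.differentiableOn hg0
      exact ((hg.contDiff (n := 2)).differentiable_deriv_two).differentiableOn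
  have hcont : ∀ ρ ∈ S, ContinuousOn (fun s => (m ρ * F ρ) * (1 / (s - ρ)))
      (rectBoundary a b c d) := fun ρ hρ =>
    continuousOn_const.mul (continuousOn_const.div (by fun_prop) (hne ρ hρ))
  have key : ∀ s ∈ rectBoundary a b c d, F s * logDeriv f s
      = (∑ ρ ∈ S, (m ρ * F ρ) * (1 / (s - ρ)))
        + ((∑ ρ ∈ S, m ρ * dslope F ρ s) + F s * logDeriv g s) := by
    intro s hs
    rw [logDeriv_eq_sum_add_logDeriv hg S m hfg (fun ρ hρ => hne ρ hρ s hs) (hg0 s (hsub hs)),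
      mul_add, ← add_assoc, ← Finset.sum_add_distrib, Finset.mul_sum]
    congr 1
    refine Finset.sum_congr rfl fun ρ hρ => ?_
    have h0 := hne ρ hρ s hs
    rw [dslope_of_ne _ (sub_ne_zero.1 h0), slope_def_field]
    field_simp
    ring
  rw [rectIntegral_congr hab hcd key, rectIntegral_add hab hcd (continuousOn_finsetSum _ hcont)
    (hreg.continuousOn.mono hsub), rectIntegral_eq_zero hab hcd hreg,
    rectIntegral_sum hab hcd S hcont, add_zero, Finset.mul_sum]
  refine Finset.sum_congr rfl fun ρ hρ => ?_
  obtain ⟨h1, h2, h3, h4⟩ := hS ρ hρ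
  rw [rectIntegral_const_mul, rectIntegral_inv h1 h2 h3 h4]
  ring

end Rectangle

theorem norm_exp_mul_ofReal_le (ℓ : ℝ) {s : ℂ} {B : ℝ} (h : |s.re| ≤ B) :
    ‖Complex.exp (s * ℓ)‖ ≤ Real.exp (B * |ℓ|) := by
  rw [Complex.norm_exp]
  apply Real.exp_le_exp.2
  simp only [mul_re, ofReal_re, ofReal_im, mul_zero, sub_zero]
  calc s.re * ℓ ≤ |s.re * ℓ| := le_abs_self _
    _ = |s.re| * |ℓ| := abs_mul _ _
    _ ≤ B * |ℓ| := by gcongr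

theorem norm_exp_sub_exp_le (ℓ : ℝ) {s w : ℂ} {B : ℝ} (hs : |s.re| ≤ B) (hw : |w.re| ≤ B) :
    ‖Complex.exp (s * ℓ) - Complex.exp (w * ℓ)‖ ≤ |ℓ| * Real.exp (B * |ℓ|) * ‖s - w‖ := by
  have hconv : Convex ℝ {z : ℂ | |z.re| ≤ B} := by
    have : {z : ℂ | |z.re| ≤ B} = Complex.reLm ⁻¹' (Set.Icc (-B) B) := by
      ext z; simp [abs_le]
    rw [this]
    exact (convex_Icc _ _).linear_preimage _
  refine hconv.norm_image_sub_le_of_norm_hasDerivWithin_le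
    (f := fun z : ℂ => Complex.exp (z * ℓ)) (f' := fun z => Complex.exp (z * ℓ) * (1 * ℓ))
    (fun z _ => (((hasDerivAt_id z).mul_const _).cexp).hasDerivWithinAt) (fun z hz => ?_) hw hs
  rw [norm_mul, one_mul, Complex.norm_real, Real.norm_eq_abs, mul_comm]
  gcongr
  exact norm_exp_mul_ofReal_le ℓ hz

theorem norm_log_le_of_one_le {z : ℂ} {B : ℝ} (h1 : 1 ≤ ‖z‖) (h2 : ‖z‖ ≤ B) :
    ‖Complex.log z‖ ≤ B + Real.pi := by
  rw [← Complex.re_add_im (Complex.log z), Complex.log_re, Complex.log_im]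
  refine (norm_add_le _ _).trans (add_le_add ?_ ?_)
  · rw [Complex.norm_real, Real.norm_eq_abs, abs_of_nonneg (Real.log_nonneg h1)]
    linarith [Real.log_le_sub_one_of_pos (show 0 < ‖z‖ by linarith)]
  · rw [norm_mul, Complex.norm_I, mul_one, Complex.norm_real]
    exact Complex.abs_arg_le_pi z

/-- A horizontal segment passing close to `ρ` still contributes a bounded amount. -/
theorem norm_integral_exp_div_sub_le (ℓ τ : ℝ) {ρ : ℂ} (h0 : 0 ≤ ρ.re) (h1 : ρ.re ≤ 1)
    (hne : ρ.im ≠ τ) (hτ : |τ - ρ.im| ≤ 12) :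
    ‖∫ σ : ℝ in (-5 : ℝ)..6, Complex.exp ((σ + τ * I) * ℓ) / (σ + τ * I - ρ)‖
      ≤ Real.exp (6 * |ℓ|) * (11 * |ℓ| + 2 * (20 + Real.pi)) := by
  have hz : ∀ σ : ℝ, (σ + τ * I - ρ : ℂ) ≠ 0 := fun σ h => by
    have := congrArg Complex.im h
    simp at this
    exact hne (by linarith)
  have hcont : Continuous fun σ : ℝ => (1 : ℂ) / (σ + τ * I - ρ) :=
    continuous_const.div (by fun_prop) hz
  have hcont2 : Continuous fun σ : ℝ =>
      (Complex.exp ((σ + τ * I) * ℓ) - Complex.exp (ρ * ℓ)) / (σ + τ * I - ρ) :=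
    Continuous.div (by fun_prop) (by fun_prop) hz
  have hcont3 : Continuous fun σ : ℝ => Complex.exp (ρ * ℓ) * (1 / (σ + τ * I - ρ)) :=
    continuous_const.mul hcont
  have hsplit : ∫ σ : ℝ in (-5 : ℝ)..6, Complex.exp ((σ + τ * I) * ℓ) / (σ + τ * I - ρ)
      = (∫ σ : ℝ in (-5 : ℝ)..6,
          (Complex.exp ((σ + τ * I) * ℓ) - Complex.exp (ρ * ℓ)) / (σ + τ * I - ρ))
        + Complex.exp (ρ * ℓ) * ∫ σ : ℝ in (-5 : ℝ)..6, 1 / (σ + τ * I - ρ) := by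
    rw [← intervalIntegral.integral_const_mul, ← intervalIntegral.integral_add
      (hcont2.intervalIntegrable _ _) (hcont3.intervalIntegrable _ _)]
    refine intervalIntegral.integral_congr fun σ _ => ?_
    ring
  have hρ : |ρ.re| ≤ 6 := by rw [abs_le]; constructor <;> linarith
  have hA : ‖∫ σ : ℝ in (-5 : ℝ)..6,
      (Complex.exp ((σ + τ * I) * ℓ) - Complex.exp (ρ * ℓ)) / (σ + τ * I - ρ)‖
      ≤ |ℓ| * Real.exp (6 * |ℓ|) * |6 - (-5)| := by
    refine intervalIntegral.norm_integral_le_of_norm_le_const fun σ hσ => ?_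
    rw [Set.uIoc_of_le (by norm_num)] at hσ
    rw [norm_div, div_le_iff₀ (norm_pos_iff.2 (hz σ))]
    refine norm_exp_sub_exp_le ℓ ?_ hρ
    simp only [add_re, ofReal_re, mul_re, I_re, mul_zero, ofReal_im, I_im, mul_one, sub_self,
      add_zero, abs_le]
    constructor <;> linarith [hσ.1, hσ.2]
  have hn : ∀ σ : ℝ, |σ - ρ.re| ≤ 8 → ‖(σ + τ * I - ρ : ℂ)‖ ≤ 20 := fun σ hσ => by
    refine (Complex.norm_le_abs_re_add_abs_im _).trans ?_
    simp
    linarith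
  have hn1 : ∀ σ : ℝ, 1 ≤ |σ - ρ.re| → 1 ≤ ‖(σ + τ * I - ρ : ℂ)‖ := fun σ hσ => by
    refine le_trans ?_ (Complex.abs_re_le_norm _)
    simpa using hσ
  have a1 : |(6 : ℝ) - ρ.re| ≤ 8 := by rw [abs_le]; constructor <;> linarith
  have a2 : |(-5 : ℝ) - ρ.re| ≤ 8 := by rw [abs_le]; constructor <;> linarith
  have b1 : 1 ≤ |(6 : ℝ) - ρ.re| := by rw [le_abs]; left; linarith
  have b2 : 1 ≤ |(-5 : ℝ) - ρ.re| := by rw [le_abs]; right; linarith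
  have hB : ‖∫ σ : ℝ in (-5 : ℝ)..6, 1 / (σ + τ * I - ρ)‖ ≤ 2 * (20 + Real.pi) := by
    obtain ⟨k, hk, hslit⟩ : ∃ k : ℂ, ‖k‖ = 1 ∧
        ∀ σ : ℝ, k * (τ * I - ρ + σ * 1) ∈ slitPlane := by
      rcases lt_or_gt_of_ne hne with h | h
      · exact ⟨-I, by simp, fun σ => Or.inl (by simp; linarith)⟩
      · exact ⟨I, by simp, fun σ => Or.inl (by simp; linarith)⟩
    have := integral_inv_line (k := k) (p := τ * I - ρ) (q := 1) (α := -5) (β := 6)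
      fun σ _ => hslit σ
    have e : ∀ σ : ℝ, (τ * I - ρ + σ * 1 : ℂ) = σ + τ * I - ρ := fun σ => by ring
    simp only [e] at this
    rw [this, two_mul]
    refine (norm_sub_le _ _).trans (add_le_add ?_ ?_) <;>
    apply norm_log_le_of_one_le <;> rw [norm_mul, hk, one_mul]
    exacts [hn1 6 b1, hn 6 a1, hn1 (-5) b2, hn (-5) a2]
  rw [hsplit]
  calc _ ≤ |ℓ| * Real.exp (6 * |ℓ|) * |6 - (-5)|
        + Real.exp (6 * |ℓ|) * (2 * (20 + Real.pi)) := by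
        refine (norm_add_le _ _).trans (add_le_add hA ?_)
        rw [norm_mul]
        gcongr
        exact norm_exp_mul_ofReal_le ℓ hρ
    _ = _ := by norm_num; ring

theorem norm_Gamma_le_Gamma_re {s : ℂ} (hs : 0 < s.re) :
    ‖Complex.Gamma s‖ ≤ Real.Gamma s.re := by
  rw [Complex.Gamma_eq_integral hs, Real.Gamma_eq_integral hs, Complex.GammaIntegral]
  refine (MeasureTheory.norm_integral_le_integral_norm _).trans (le_of_eq ?_)
  refine MeasureTheory.setIntegral_congr_fun measurableSet_Ioi fun t ht => ?_
  simp only [norm_mul, Complex.norm_real, Real.norm_eq_abs, Real.abs_exp]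
  rw [Complex.norm_cpow_eq_rpow_re_of_pos ht, sub_re, one_re]

theorem norm_Gamma_le_of_re_mem {s : ℂ} (h2 : 2 ≤ s.re) (h6 : s.re ≤ 6) :
    ‖Complex.Gamma s‖ ≤ 120 := by
  refine (norm_Gamma_le_Gamma_re (by linarith)).trans ?_
  have : Real.Gamma 6 = 120 := by
    rw [show (6 : ℝ) = (5 : ℕ) + 1 by norm_num, Real.Gamma_nat_eq_factorial]
    norm_num [Nat.factorial]
  rw [← this]
  exact Real.Gamma_strictMonoOn_Ici.monotoneOn h2 (by norm_num) h6

theorem norm_sin_I_mul_le (u : ℝ) : ‖Complex.sin (u * I)‖ ≤ Real.exp |u| := by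
  rw [Complex.sin_mul_I, norm_mul, Complex.norm_I, mul_one, ← Complex.ofReal_sinh,
    Complex.norm_real, Real.norm_eq_abs, Real.abs_sinh, Real.sinh_eq]
  have := Real.exp_pos (-|u|)
  have := Real.exp_pos |u|
  linarith

theorem exp_neg_le_norm_Gamma_one_add {u : ℝ} (hu : 1 ≤ |u|) :
    Real.exp (-(Real.pi * |u|)) ≤ ‖Complex.Gamma (1 + u * I)‖ := by
  have hu0 : (u * I : ℂ) ≠ 0 := by
    have : u ≠ 0 := by rintro rfl; simp at hu; linarith
    simp [this]
  have h1 : ‖Complex.Gamma (1 - u * I)‖ ≤ 1 := by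
    refine (norm_Gamma_le_Gamma_re (by simp)).trans (by simp)
  have h2 := Complex.Gamma_mul_Gamma_one_sub (u * I)
  have h3 : Complex.sin (Real.pi * (u * I)) ≠ 0 := by
    intro h
    rw [Complex.sin_eq_zero_iff] at h
    obtain ⟨k, hk⟩ := h
    have := congrArg Complex.im hk
    have hpi := Real.pi_ne_zero
    have hu' : u ≠ 0 := by rintro rfl; simp at hu; linarith
    simp [hpi, hu'] at this
  have h4 : Complex.Gamma (1 + u * I) * Complex.Gamma (1 - u * I)
      * Complex.sin ((Real.pi * u : ℝ) * I) = Real.pi * (u * I) := by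
    rw [add_comm, Complex.Gamma_add_one _ hu0, mul_assoc (u * I : ℂ), h2]
    push_cast
    rw [mul_assoc (Real.pi : ℂ), mul_assoc (u * I : ℂ), div_mul_cancel₀ _ h3]
    ring
  have h5 := congrArg norm h4
  rw [norm_mul, norm_mul] at h5
  have h6 : ‖(Real.pi * (u * I) : ℂ)‖ = Real.pi * |u| := by
    simp [abs_of_pos Real.pi_pos]
  rw [h6] at h5
  have h7 := norm_sin_I_mul_le (Real.pi * u)
  rw [abs_mul, abs_of_pos Real.pi_pos] at h7
  rw [Real.exp_neg, inv_le_iff_one_le_mul₀ (Real.exp_pos _)]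
  calc (1 : ℝ) ≤ Real.pi * |u| := by nlinarith [Real.pi_gt_three]
    _ = ‖Complex.Gamma (1 + u * I)‖ * ‖Complex.Gamma (1 - u * I)‖
        * ‖Complex.sin ((Real.pi * u : ℝ) * I)‖ := h5.symm
    _ ≤ ‖Complex.Gamma (1 + u * I)‖ * 1 * Real.exp (Real.pi * |u|) := by gcongr
    _ = _ := by ring

theorem norm_Gamma_le_norm_Gamma_add_one {s : ℂ} (hs : 1 ≤ s.re) :
    ‖Complex.Gamma s‖ ≤ ‖Complex.Gamma (s + 1)‖ := by
  have h0 : s ≠ 0 := by rintro rfl; simp at hs; linarith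
  rw [Complex.Gamma_add_one s h0, norm_mul]
  have : 1 ≤ ‖s‖ := hs.trans ((le_abs_self _).trans (Complex.abs_re_le_norm s))
  nlinarith [norm_nonneg (Complex.Gamma s)]

theorem exp_neg_le_norm_Gamma_three_add {u : ℝ} (hu : 1 ≤ |u|) :
    Real.exp (-(Real.pi * |u|)) ≤ ‖Complex.Gamma (3 + u * I)‖ := by
  refine (exp_neg_le_norm_Gamma_one_add hu).trans ?_
  have h1 := norm_Gamma_le_norm_Gamma_add_one (s := 1 + u * I) (by simp)
  have h2 := norm_Gamma_le_norm_Gamma_add_one (s := 1 + u * I + 1) (by simp)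
  refine (h1.trans h2).trans (le_of_eq ?_)
  ring_nf

theorem differentiableAt_Gamma_of_re_pos {s : ℂ} (hs : 0 < s.re) :
    DifferentiableAt ℂ Complex.Gamma s := by
  refine Complex.differentiableAt_Gamma s fun n h => ?_
  rw [h] at hs
  simp at hs
  linarith [n.cast_nonneg (α := ℝ)]

theorem differentiableOn_digamma :
    DifferentiableOn ℂ Complex.digamma {s | 0 < s.re} := by
  have ho : IsOpen {s : ℂ | 0 < s.re} := isOpen_lt continuous_const Complex.continuous_re
  have hd : DifferentiableOn ℂ Complex.Gamma {s | 0 < s.re} := fun s hs =>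
    (differentiableAt_Gamma_of_re_pos hs).differentiableWithinAt
  exact (hd.deriv ho).div hd fun s hs => Complex.Gamma_ne_zero_of_re_pos hs

theorem norm_digamma_le {u : ℝ} (hu : 1 ≤ u) {s : ℂ}
    (hs : s ∈ Metric.closedBall (4 + u * I : ℂ) 1) : ‖Complex.digamma s‖ ≤ 144 * u := by
  have hre : ∀ s ∈ Metric.ball (4 + u * I : ℂ) 2, 2 ≤ s.re ∧ s.re ≤ 6 := fun s hs => by
    have := (Complex.abs_re_le_norm (s - (4 + u * I))).trans (mem_ball_iff_norm.1 hs).le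
    simp [abs_le] at this
    constructor <;> linarith
  have hL : 0 < Real.pi * u + 5 := by nlinarith [Real.pi_pos]
  have h120 : (120 : ℝ) ≤ Real.exp 5 := by
    have h1 := Real.exp_one_gt_d9
    have h2 : Real.exp 5 = Real.exp 1 ^ 5 := by rw [← Real.exp_nat_mul]; norm_num
    rw [h2]
    calc (120 : ℝ) ≤ 2.7 ^ 5 := by norm_num
      _ ≤ _ := by gcongr; linarith
  have hlow : Real.exp (-(Real.pi * u)) ≤ ‖Complex.Gamma (4 + u * I)‖ := by
    have h1 := exp_neg_le_norm_Gamma_three_add (u := u) (by rwa [abs_of_nonneg (by linarith)])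
    have h2 := norm_Gamma_le_norm_Gamma_add_one (s := 3 + u * I) (by simp)
    rw [abs_of_nonneg (by linarith)] at h1
    refine (h1.trans h2).trans (le_of_eq ?_)
    ring_nf
  have := norm_logDeriv_le_of_zeroFree (g := Complex.Gamma) (c := 4 + u * I) one_pos one_lt_two hL
    (fun s hs => (differentiableAt_Gamma_of_re_pos
      (by linarith [(hre s hs).1])).differentiableWithinAt)
    (fun s hs => Complex.Gamma_ne_zero_of_re_pos (by linarith [(hre s hs).1]))
    (fun s hs => by
      refine (norm_Gamma_le_of_re_mem (hre s hs).1 (hre s hs).2).trans ?_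
      calc (120 : ℝ) ≤ Real.exp 5 := h120
        _ = Real.exp (Real.pi * u + 5) * Real.exp (-(Real.pi * u)) := by
          rw [← Real.exp_add]; ring_nf
        _ ≤ _ := by gcongr) s hs
  rw [Complex.digamma_def]
  refine this.trans ?_
  nlinarith [Real.pi_lt_four]

/-- The oscillatory integral of the digamma function along `Re s = 3` grows at most linearly. -/
theorem exists_norm_integral_digamma_mul_exp_le {ℓ u₀ : ℝ} (hℓ : ℓ ≠ 0) :
    ∃ C, 0 ≤ C ∧ ∀ U, 1 ≤ U → u₀ ≤ U →
      ‖∫ u : ℝ in u₀..U, Complex.digamma (3 + u * I) * Complex.exp (u * I * ℓ)‖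
        ≤ C * (U + |u₀|) := by
  set F : ℂ → ℂ := fun s => Complex.digamma s * Complex.exp ((s - 3) * ℓ) with hF
  have hFd : DifferentiableOn ℂ F {s | 0 < s.re} :=
    differentiableOn_digamma.mul (by fun_prop)
  set B : ℝ := ‖∫ x : ℝ in (3 : ℝ)..4, F (x + u₀ * I)‖ with hB
  have hk : (Complex.exp ℓ - 1 : ℂ) ≠ 0 := by
    rw [sub_ne_zero, ← Complex.ofReal_exp]
    norm_cast
    rwa [Real.exp_eq_one_iff]
  refine ⟨(B + 144 * Real.exp |ℓ| + Real.exp ℓ) / ‖Complex.exp ℓ - 1‖, by positivity,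
    fun U hU hU0 => ?_⟩
  set K := ∫ u : ℝ in u₀..U, Complex.digamma (3 + u * I) * Complex.exp (u * I * ℓ) with hK
  have hrect := rectIntegral_eq_zero (a := 3) (b := 4) (f := F) (by norm_num) hU0
    (hFd.mono fun s hs => by
      have : (3 : ℝ) ≤ s.re := hs.1.1
      simp only [Set.mem_ofPred_eq]
      linarith)
  have hleft : (∫ y : ℝ in u₀..U, F ((3 : ℝ) + y * I)) = K := by
    refine intervalIntegral.integral_congr fun y _ => ?_
    simp [hF]
  set J := ∫ y : ℝ in u₀..U, Complex.exp (y * I * ℓ) / (3 + y * I) with hJ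
  have hne : ∀ y : ℝ, (3 + y * I : ℂ) ≠ 0 := fun y h => by
    have := congrArg Complex.re h
    simp at this
  have hright : (∫ y : ℝ in u₀..U, F ((4 : ℝ) + y * I)) = Complex.exp ℓ * (K + J) := by
    have i1 : Continuous fun y : ℝ => Complex.digamma (3 + y * I) * Complex.exp (y * I * ℓ) := by
      refine Continuous.mul ?_ (by fun_prop)
      exact differentiableOn_digamma.continuousOn.comp_continuous (by fun_prop) fun y => by simp
    have i2 : Continuous fun y : ℝ => Complex.exp (y * I * ℓ) / (3 + y * I) :=
      Continuous.div (by fun_prop) (by fun_prop) hne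
    rw [hK, hJ, ← intervalIntegral.integral_add (i1.intervalIntegrable _ _)
      (i2.intervalIntegrable _ _), ← intervalIntegral.integral_const_mul]
    refine intervalIntegral.integral_congr fun y _ => ?_
    have e1 : ((4 : ℝ) + y * I : ℂ) = (3 + y * I) + 1 := by push_cast; ring
    have e2 : Complex.exp ((((4 : ℝ) + y * I : ℂ) - 3) * ℓ)
        = Complex.exp ℓ * Complex.exp (y * I * ℓ) := by
      rw [← Complex.exp_add]; congr 1; push_cast; ring
    simp only [hF]
    rw [e2, e1, Complex.digamma_apply_add_one _ fun n h => by
      have := congrArg Complex.re h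
      simp at this
      linarith [n.cast_nonneg (α := ℝ)]]
    field_simp
  have htop : ‖∫ x : ℝ in (3 : ℝ)..4, F (x + U * I)‖ ≤ 144 * U * Real.exp |ℓ| * |4 - 3| := by
    refine intervalIntegral.norm_integral_le_of_norm_le_const fun x hx => ?_
    rw [Set.uIoc_of_le (by norm_num)] at hx
    simp only [hF, norm_mul]
    gcongr
    · refine norm_digamma_le hU ?_
      rw [mem_closedBall_iff_norm]
      have : (x + U * I - (4 + U * I) : ℂ) = ((x - 4 : ℝ) : ℂ) := by push_cast; ring
      rw [this, Complex.norm_real, Real.norm_eq_abs, abs_le]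
      constructor <;> linarith [hx.1, hx.2]
    · have := norm_exp_mul_ofReal_le ℓ (s := x + U * I - 3) (B := 1) (by
        simp [abs_le]; constructor <;> linarith [hx.1, hx.2])
      simpa using this
  have hJb : ‖J‖ ≤ 1 * |U - u₀| := by
    refine intervalIntegral.norm_integral_le_of_norm_le_const fun y _ => ?_
    have e : ‖Complex.exp (y * I * ℓ)‖ = 1 := by
      have : (y * I * ℓ : ℂ) = ((y * ℓ : ℝ) : ℂ) * I := by push_cast; ring
      rw [this, Complex.norm_exp_ofReal_mul_I]
    rw [norm_div, e, div_le_one (norm_pos_iff.2 (hne y))]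
    refine le_trans ?_ (Complex.abs_re_le_norm _)
    simp
  rw [abs_of_nonneg (by linarith)] at hJb
  rw [rectIntegral, hleft, hright] at hrect
  have hkey : (Complex.exp ℓ - 1) * K = I * (∫ x : ℝ in (3 : ℝ)..4, F (x + u₀ * I))
      - I * (∫ x : ℝ in (3 : ℝ)..4, F (x + U * I)) - Complex.exp ℓ * J := by
    linear_combination (-I) * hrect + (Complex.exp ℓ * (K + J) - K) * I_mul_I
  have hnorm := congrArg norm hkey
  rw [norm_mul] at hnorm
  rw [div_mul_eq_mul_div, le_div_iff₀ (norm_pos_iff.2 hk), mul_comm, hnorm]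
  have hu0 := neg_abs_le u₀
  have hE := Real.exp_pos ℓ
  have hE2 := Real.exp_pos |ℓ|
  have hB0 : 0 ≤ B := norm_nonneg _
  have hu1 := abs_nonneg u₀
  calc _ ≤ B + 144 * U * Real.exp |ℓ| * |4 - 3| + Real.exp ℓ * (1 * (U - u₀)) := by
        refine (norm_sub_le _ _).trans (add_le_add ((norm_sub_le _ _).trans (add_le_add ?_ ?_)) ?_)
        · rw [norm_mul, Complex.norm_I, one_mul]
        · rw [norm_mul, Complex.norm_I, one_mul]; exact htop
        · rw [norm_mul, ← Complex.ofReal_exp, Complex.norm_real, Real.norm_eq_abs, Real.abs_exp]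
          gcongr
    _ ≤ _ := by
        norm_num
        have a1 : B * 1 ≤ B * (U + |u₀|) := by gcongr; linarith
        have a2 : Real.exp |ℓ| * U ≤ Real.exp |ℓ| * (U + |u₀|) := by gcongr; linarith
        have a3 : Real.exp ℓ * (U - u₀) ≤ Real.exp ℓ * (U + |u₀|) := by gcongr; linarith
        linarith

theorem exists_norm_mellin_le {f : ℝ → ℂ} (hf : ∀ s, MellinConvergent f s) (a b : ℝ) :
    ∃ M, 0 ≤ M ∧ ∀ s : ℂ, a ≤ s.re → s.re ≤ b → ‖mellin f s‖ ≤ M := by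
  have hn : ∀ (s : ℂ), MeasureTheory.IntegrableOn (fun t : ℝ => t ^ (s.re - 1) * ‖f t‖)
      (Set.Ioi 0) := fun s => by
    refine MeasureTheory.IntegrableOn.congr_fun (MeasureTheory.Integrable.norm (hf s))
      (fun t ht => ?_) measurableSet_Ioi
    simp only [norm_smul]
    rw [Complex.norm_cpow_eq_rpow_re_of_pos ht, sub_re, one_re]
  have ha : MeasureTheory.IntegrableOn (fun t : ℝ => t ^ (a - 1) * ‖f t‖) (Set.Ioi 0) := hn a
  have hb : MeasureTheory.IntegrableOn (fun t : ℝ => t ^ (b - 1) * ‖f t‖) (Set.Ioi 0) := hn b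
  refine ⟨∫ t in Set.Ioi (0 : ℝ), (t ^ (a - 1) * ‖f t‖ + t ^ (b - 1) * ‖f t‖), ?_,
    fun s h1 h2 => ?_⟩
  · refine MeasureTheory.setIntegral_nonneg measurableSet_Ioi fun t ht => ?_
    have : (0 : ℝ) ≤ t := le_of_lt ht
    positivity
  · refine MeasureTheory.norm_integral_le_of_norm_le (ha.add hb) ?_
    refine (MeasureTheory.ae_restrict_iff' measurableSet_Ioi).2
      (Eventually.of_forall fun t ht => ?_)
    have ht0 : (0 : ℝ) < t := ht
    rw [norm_smul, Complex.norm_cpow_eq_rpow_re_of_pos ht, sub_re, one_re, ← add_mul]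
    gcongr
    rcases le_total t 1 with h | h
    · have := Real.rpow_le_rpow_of_exponent_ge ht0 h (show a - 1 ≤ s.re - 1 by linarith)
      have := Real.rpow_nonneg ht0.le (b - 1)
      linarith
    · have := Real.rpow_le_rpow_of_exponent_le h (show s.re - 1 ≤ b - 1 by linarith)
      have := Real.rpow_nonneg ht0.le (a - 1)
      linarith

theorem exists_norm_completedRiemannZeta₀_le (a b : ℝ) :
    ∃ M, 0 ≤ M ∧ ∀ s : ℂ, a ≤ s.re → s.re ≤ b → ‖completedRiemannZeta₀ s‖ ≤ M := by
  set P := HurwitzZeta.hurwitzEvenFEPair 0 with hP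
  have hconv : ∀ s, MellinConvergent P.f_modif s := fun s =>
    P.isStrongFEPair_toStrongFEPair.hasMellin s |>.1
  obtain ⟨M, hM, h⟩ := exists_norm_mellin_le hconv (a / 2) (b / 2)
  refine ⟨M, hM, fun s h1 h2 => ?_⟩
  have e : completedRiemannZeta₀ s = mellin P.f_modif (s / 2) / 2 := rfl
  rw [e, norm_div]
  have := h (s / 2) (by simp; linarith) (by simp; linarith)
  have h3 := norm_nonneg (mellin P.f_modif (s / 2))
  norm_num
  linarith

/-- The entire function `s (s - 1) π ^ (-s / 2) Γ (s / 2) ζ s`. -/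
noncomputable def riemannXi (s : ℂ) : ℂ := s * (s - 1) * completedRiemannZeta₀ s + 1

theorem differentiable_riemannXi : Differentiable ℂ riemannXi :=
  ((differentiable_id.mul (differentiable_id.sub_const 1)).mul
    differentiable_completedZeta₀).add_const 1

theorem riemannXi_one_sub (s : ℂ) : riemannXi (1 - s) = riemannXi s := by
  rw [riemannXi, riemannXi, completedRiemannZeta₀_one_sub]
  ring

theorem riemannXi_eq_of_re_pos {s : ℂ} (hs : 0 < s.re) (h1 : s ≠ 1) :
    riemannXi s = s * (s - 1) * Gammaℝ s * riemannZeta s := by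
  have h0 : s ≠ 0 := by rintro rfl; simp at hs
  have h2 : s - 1 ≠ 0 := sub_ne_zero.2 h1
  have h3 : 1 - s ≠ 0 := sub_ne_zero.2 h1.symm
  rw [mul_assoc _ (Gammaℝ s), riemannZeta_def_of_ne_zero h0,
    mul_div_cancel₀ _ (Gammaℝ_ne_zero_of_re_pos hs), completedRiemannZeta_eq, riemannXi]
  field_simp
  ring

theorem riemannXi_ne_zero_of_one_le_re {s : ℂ} (hs : 1 ≤ s.re) : riemannXi s ≠ 0 := by
  by_cases h1 : s = 1
  · simp [h1, riemannXi]
  · have h0 : s ≠ 0 := by rintro rfl; simp at hs; linarith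
    rw [riemannXi_eq_of_re_pos (by linarith) h1]
    exact mul_ne_zero (mul_ne_zero (mul_ne_zero h0 (sub_ne_zero.2 h1))
      (Gammaℝ_ne_zero_of_re_pos (by linarith))) (riemannZeta_ne_zero_of_one_le_re hs)

theorem riemannXi_eq_zero_iff {s : ℂ} :
    riemannXi s = 0 ↔ riemannZeta s = 0 ∧ 0 < s.re ∧ s.re < 1 := by
  constructor
  · intro h
    have h1 : s.re < 1 := by
      by_contra! h1
      exact riemannXi_ne_zero_of_one_le_re h1 h
    have h0 : 0 < s.re := by
      by_contra! h0
      refine riemannXi_ne_zero_of_one_le_re (s := 1 - s) (by simp; linarith) ?_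
      rw [riemannXi_one_sub, h]
    refine ⟨?_, h0, h1⟩
    have hs1 : s ≠ 1 := by rintro rfl; simp at h1
    have hs0 : s ≠ 0 := by rintro rfl; simp at h0
    rw [riemannXi_eq_of_re_pos h0 hs1] at h
    simpa [hs0, sub_ne_zero.2 hs1, Gammaℝ_ne_zero_of_re_pos h0] using h
  · rintro ⟨hz, h0, h1⟩
    rw [riemannXi_eq_of_re_pos h0 (by rintro rfl; simp at h1), hz, mul_zero]

theorem Gammaℝ_differentiableAt {s : ℂ} (hs : 0 < s.re) : DifferentiableAt ℂ Gammaℝ s := by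
  have hpi : (Real.pi : ℂ) ≠ 0 := ofReal_ne_zero.2 Real.pi_ne_zero
  have h1 : DifferentiableAt ℂ (fun s : ℂ => (Real.pi : ℂ) ^ (-s / 2)) s :=
    (by fun_prop : DifferentiableAt ℂ (fun s : ℂ => -s / 2) s).const_cpow (Or.inl hpi)
  have h2 : DifferentiableAt ℂ (fun s : ℂ => Complex.Gamma (s / 2)) s :=
    (differentiableAt_Gamma_of_re_pos (s := s / 2) (by simp; linarith)).comp s (by fun_prop)
  exact h1.mul h2

theorem riemannXi_local_factorization {ρ : ℂ} {n : ℕ} (h0 : 0 < ρ.re) (h1 : ρ.re < 1)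
    (h : ∃ g : ℂ → ℂ, AnalyticAt ℂ g ρ ∧ g ρ ≠ 0 ∧
      ∀ᶠ w in nhds ρ, riemannZeta w = (w - ρ) ^ n * g w) :
    ∃ g : ℂ → ℂ, AnalyticAt ℂ g ρ ∧ g ρ ≠ 0 ∧
      ∀ᶠ w in nhds ρ, riemannXi w = (w - ρ) ^ n * g w := by
  obtain ⟨g, hg, hg0, hgw⟩ := h
  have ho : IsOpen {s : ℂ | 0 < s.re} := isOpen_lt continuous_const Complex.continuous_re
  have ho1 : IsOpen {s : ℂ | s.re < 1} := isOpen_lt Complex.continuous_re continuous_const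
  have hu : AnalyticAt ℂ (fun s => s * (s - 1) * Gammaℝ s) ρ := by
    refine DifferentiableOn.analyticAt (s := {s : ℂ | 0 < s.re}) (fun s hs => ?_) (ho.mem_nhds h0)
    exact ((by fun_prop : DifferentiableAt ℂ (fun s : ℂ => s * (s - 1)) s).mul
      (Gammaℝ_differentiableAt hs)).differentiableWithinAt
  refine ⟨fun s => s * (s - 1) * Gammaℝ s * g s, hu.mul hg, ?_, ?_⟩
  · have hs1 : ρ ≠ 1 := by rintro rfl; simp at h1
    have hs0 : ρ ≠ 0 := by rintro rfl; simp at h0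
    simp [hs0, sub_ne_zero.2 hs1, Gammaℝ_ne_zero_of_re_pos h0, hg0]
  · filter_upwards [hgw, ho.mem_nhds h0, ho1.mem_nhds h1] with w hw hw0 hw1
    have hw1' : w.re < 1 := hw1
    rw [riemannXi_eq_of_re_pos hw0 (by rintro rfl; simp at hw1'), hw]
    ring

theorem norm_LSeries_le_tsum_norm_term {f : ℕ → ℂ} {σ : ℝ} (hf : LSeriesSummable f σ) {s : ℂ}
    (hs : s.re = σ) : ‖LSeries f s‖ ≤ ∑' n, ‖LSeries.term f σ n‖ := by
  have e : ∀ n, ‖LSeries.term f s n‖ = ‖LSeries.term f σ n‖ := fun n => by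
    simp [LSeries.norm_term_eq, hs]
  have hsum : Summable fun n => ‖LSeries.term f s n‖ := by simpa only [e] using hf.norm
  have h := norm_tsum_le_tsum_norm hsum
  simp only [e] at h
  exact h

theorem exists_one_le_mul_norm_riemannZeta :
    ∃ M, 0 < M ∧ ∀ s : ℂ, s.re = 6 → 1 ≤ M * ‖riemannZeta s‖ := by
  have hsum : LSeriesSummable (fun n => (ArithmeticFunction.moebius n : ℂ)) ((6 : ℝ) : ℂ) :=
    ArithmeticFunction.LSeriesSummable_moebius_iff.2 (by norm_num)
  refine ⟨(∑' n, ‖LSeries.term (fun n => (ArithmeticFunction.moebius n : ℂ)) ((6 : ℝ) : ℂ) n‖) + 1,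
    by positivity, fun s hs => ?_⟩
  have h1 := norm_LSeries_le_tsum_norm_term hsum hs
  have h2 := ArithmeticFunction.LSeries_zeta_mul_Lseries_moebius (s := s) (by rw [hs]; norm_num)
  rw [ArithmeticFunction.LSeries_zeta_eq_riemannZeta (by rw [hs]; norm_num)] at h2
  have h3 := congrArg norm h2
  rw [norm_mul, norm_one] at h3
  rw [← h3, mul_comm]
  gcongr
  linarith

theorem exists_norm_logDeriv_riemannZeta_le :
    ∃ M, 0 ≤ M ∧ ∀ s : ℂ, s.re = 6 → ‖logDeriv riemannZeta s‖ ≤ M := by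
  have hsum : LSeriesSummable (fun n => (ArithmeticFunction.vonMangoldt n : ℂ)) ((6 : ℝ) : ℂ) :=
    ArithmeticFunction.LSeriesSummable_vonMangoldt (by norm_num)
  refine ⟨∑' n, ‖LSeries.term (fun n => (ArithmeticFunction.vonMangoldt n : ℂ)) ((6 : ℝ) : ℂ) n‖,
    by positivity, fun s hs => ?_⟩
  have h1 := norm_LSeries_le_tsum_norm_term hsum hs
  rw [ArithmeticFunction.LSeries_vonMangoldt_eq_deriv_riemannZeta_div (by rw [hs]; norm_num),
    neg_div, norm_neg] at h1
  rwa [logDeriv_apply]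

theorem exists_norm_riemannXi_le (a b : ℝ) :
    ∃ M, 0 < M ∧ ∀ s : ℂ, a ≤ s.re → s.re ≤ b → ‖riemannXi s‖ ≤ M * (1 + ‖s‖) ^ 2 := by
  obtain ⟨M, hM, h⟩ := exists_norm_completedRiemannZeta₀_le a b
  refine ⟨M + 1, by linarith, fun s h1 h2 => ?_⟩
  have h3 := h s h1 h2
  have h4 : ‖s - 1‖ ≤ 1 + ‖s‖ := by
    have := norm_sub_le s 1
    rw [norm_one] at this
    linarith
  have h5 : (1 : ℝ) ≤ (1 + ‖s‖) ^ 2 := one_le_pow₀ (by linarith [norm_nonneg s])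
  calc ‖riemannXi s‖ ≤ ‖s‖ * ‖s - 1‖ * ‖completedRiemannZeta₀ s‖ + 1 := by
        refine (norm_add_le _ _).trans ?_
        rw [norm_mul, norm_mul, norm_one]
    _ ≤ (1 + ‖s‖) * (1 + ‖s‖) * M + (1 + ‖s‖) ^ 2 := by
        gcongr
        linarith
    _ = _ := by ring

theorem exists_exp_neg_le_mul_norm_riemannXi :
    ∃ M, 0 < M ∧ ∀ T : ℝ, 2 ≤ T → Real.exp (-(2 * T)) ≤ M * ‖riemannXi (6 + T * I)‖ := by
  obtain ⟨M, hM, h⟩ := exists_one_le_mul_norm_riemannZeta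
  refine ⟨Real.pi ^ 3 * M, by positivity, fun T hT => ?_⟩
  set s : ℂ := 6 + T * I with hs
  have hre : s.re = 6 := by simp [hs]
  have h1 : s ≠ 1 := by intro h; rw [h] at hre; norm_num at hre
  have hz := h s hre
  have hΓ := exp_neg_le_norm_Gamma_three_add (u := T / 2) (by rw [abs_of_pos] <;> linarith)
  rw [abs_of_pos (by linarith)] at hΓ
  have hs2 : s / 2 = 3 + (T / 2 : ℝ) * I := by rw [hs]; push_cast; ring
  rw [← hs2] at hΓ
  have hn1 : 1 ≤ ‖s‖ := by
    have := (le_abs_self _).trans (Complex.abs_re_le_norm s)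
    linarith
  have hn2 : 1 ≤ ‖s - 1‖ := by
    have := (le_abs_self _).trans (Complex.abs_re_le_norm (s - 1))
    simp only [sub_re, one_re] at this
    linarith
  have hpi : ‖(Real.pi : ℂ) ^ (-s / 2)‖ = (Real.pi ^ 3)⁻¹ := by
    rw [Complex.norm_cpow_eq_rpow_re_of_pos Real.pi_pos]
    have : (-s / 2).re = -((3 : ℕ) : ℝ) := by simp [hre]; norm_num
    rw [this, Real.rpow_neg Real.pi_pos.le, Real.rpow_natCast]
  have hpi3 : 0 < Real.pi ^ 3 := by positivity
  rw [riemannXi_eq_of_re_pos (by rw [hre]; norm_num) h1, Gammaℝ_def]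
  simp only [norm_mul, hpi]
  calc Real.exp (-(2 * T)) ≤ Real.exp (-(Real.pi * (T / 2))) := by
        apply Real.exp_le_exp.2
        nlinarith [Real.pi_lt_four]
    _ ≤ ‖Complex.Gamma (s / 2)‖ := hΓ
    _ = 1 * 1 * (1 * ‖Complex.Gamma (s / 2)‖) * 1 := by ring
    _ ≤ ‖s‖ * ‖s - 1‖ * (1 * ‖Complex.Gamma (s / 2)‖) * (M * ‖riemannZeta s‖) := by
        gcongr
    _ = _ := by field_simp

theorem exists_norm_riemannXi_le_exp_mul :
    ∃ C, 0 < C ∧ ∀ T : ℝ, 2 ≤ T → ∀ s ∈ Metric.closedBall (6 + T * I : ℂ) 36,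
      ‖riemannXi s‖ ≤ Real.exp (C * T) * ‖riemannXi (6 + T * I)‖ := by
  obtain ⟨M, hM, h⟩ := exists_norm_riemannXi_le (-30) 42
  obtain ⟨N, hN, h'⟩ := exists_exp_neg_le_mul_norm_riemannXi
  refine ⟨M * 2500 * N + 4, by positivity, fun T hT s hs => ?_⟩
  rw [mem_closedBall_iff_norm] at hs
  have hre := (Complex.abs_re_le_norm (s - (6 + T * I))).trans hs
  simp [abs_le] at hre
  have h1 := h s (by linarith [hre.1]) (by linarith [hre.2])
  have h2 := h' T hT
  have h3 : ‖s‖ ≤ 42 + T := by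
    have e : s = (s - (6 + T * I)) + (6 + T * I) := by ring
    rw [e]
    refine (norm_add_le _ _).trans ?_
    have : ‖(6 + T * I : ℂ)‖ ≤ 6 + T := by
      refine (norm_add_le _ _).trans ?_
      simp [abs_of_nonneg (show (0 : ℝ) ≤ T by linarith)]
    linarith
  have h4 : T + 1 ≤ Real.exp T := Real.add_one_le_exp T
  have h5 : 1 + ‖s‖ ≤ 50 * Real.exp T := by linarith
  have h6 : M * 2500 * N ≤ Real.exp (M * 2500 * N * T) := by
    have := Real.add_one_le_exp (M * 2500 * N * T)
    have : 0 < M * 2500 * N := by positivity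
    nlinarith
  have h7 : Real.exp T ^ 2 = Real.exp (4 * T) * Real.exp (-(2 * T)) := by
    rw [← Real.exp_add, ← Real.exp_nat_mul]
    congr 1
    push_cast
    ring
  calc ‖riemannXi s‖ ≤ M * (1 + ‖s‖) ^ 2 := h1
    _ ≤ M * (50 * Real.exp T) ^ 2 := by gcongr
    _ = M * 2500 * Real.exp (4 * T) * Real.exp (-(2 * T)) := by rw [mul_pow, h7]; ring
    _ ≤ M * 2500 * Real.exp (4 * T) * (N * ‖riemannXi (6 + T * I)‖) := by gcongr
    _ = M * 2500 * N * Real.exp (4 * T) * ‖riemannXi (6 + T * I)‖ := by ring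
    _ ≤ Real.exp (M * 2500 * N * T) * Real.exp (4 * T) * ‖riemannXi (6 + T * I)‖ := by gcongr
    _ = _ := by rw [← Real.exp_add]; ring_nf

theorem logDeriv_Gammaℝ {s : ℂ} (hs : 0 < s.re) :
    logDeriv Gammaℝ s = -(Real.log Real.pi : ℂ) / 2 + Complex.digamma (s / 2) / 2 := by
  have hpi : (Real.pi : ℂ) ≠ 0 := ofReal_ne_zero.2 Real.pi_ne_zero
  have h1 : HasDerivAt (fun s : ℂ => (Real.pi : ℂ) ^ (-s / 2))
      ((Real.pi : ℂ) ^ (-s / 2) * Complex.log Real.pi * (-1 / 2)) s :=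
    (((hasDerivAt_id s).neg).div_const 2).const_cpow (Or.inl hpi)
  have h2 : HasDerivAt (fun s : ℂ => Complex.Gamma (s / 2))
      (deriv Complex.Gamma (s / 2) * (1 / 2)) s :=
    HasDerivAt.comp s (differentiableAt_Gamma_of_re_pos (s := s / 2)
      (by simp; linarith)).hasDerivAt ((hasDerivAt_id s).div_const 2)
  have h3 : (Real.pi : ℂ) ^ (-s / 2) ≠ 0 := by simp [cpow_eq_zero_iff, hpi]
  have h4 : Complex.Gamma (s / 2) ≠ 0 := Complex.Gamma_ne_zero_of_re_pos (by simp; linarith)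
  have e : Gammaℝ = fun s => (Real.pi : ℂ) ^ (-s / 2) * Complex.Gamma (s / 2) := rfl
  rw [e, logDeriv_mul s h3 h4 h1.differentiableAt h2.differentiableAt, logDeriv_apply,
    logDeriv_apply, h1.deriv, h2.deriv, Complex.digamma_def, logDeriv_apply,
    ← Complex.ofReal_log Real.pi_pos.le]
  field_simp

/-- On the line `Re s = 6` the logarithmic derivative of `riemannXi` is a bounded perturbation of
half a digamma function. -/
theorem exists_norm_logDeriv_riemannXi_sub_digamma_le :
    ∃ M, 0 ≤ M ∧ ∀ s : ℂ, s.re = 6 →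
      ‖logDeriv riemannXi s - Complex.digamma (s / 2) / 2‖ ≤ M := by
  obtain ⟨M, hM, h⟩ := exists_norm_logDeriv_riemannZeta_le
  refine ⟨2 + ‖(-(Real.log Real.pi : ℂ) / 2)‖ + M, by positivity, fun s hs => ?_⟩
  have h1 : s ≠ 1 := by intro h; rw [h] at hs; norm_num at hs
  have h0 : s ≠ 0 := by intro h; rw [h] at hs; norm_num at hs
  have hp : 0 < s.re := by rw [hs]; norm_num
  have hs1 : s - 1 ≠ 0 := sub_ne_zero.2 h1
  have hG := Gammaℝ_ne_zero_of_re_pos hp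
  have hζ := riemannZeta_ne_zero_of_one_le_re (s := s) (by rw [hs]; norm_num)
  have heq : riemannXi =ᶠ[nhds s] fun s => s * (s - 1) * Gammaℝ s * riemannZeta s := by
    have ho : IsOpen {s : ℂ | 1 < s.re} := isOpen_lt continuous_const Complex.continuous_re
    filter_upwards [ho.mem_nhds (show (1 : ℝ) < s.re by rw [hs]; norm_num)] with w hw
    have hw' : 1 < w.re := hw
    exact riemannXi_eq_of_re_pos (by linarith) (by rintro rfl; simp at hw')
  have hl : logDeriv riemannXi s = 1 / s + 1 / (s - 1) + logDeriv Gammaℝ s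
      + logDeriv riemannZeta s := by
    rw [logDeriv_apply, heq.deriv_eq, heq.eq_of_nhds,
      ← logDeriv_apply (fun s => s * (s - 1) * Gammaℝ s * riemannZeta s),
      logDeriv_mul (f := fun s => s * (s - 1) * Gammaℝ s) (g := riemannZeta) s
        (mul_ne_zero (mul_ne_zero h0 hs1) hG) hζ
        ((by fun_prop : DifferentiableAt ℂ (fun s : ℂ => s * (s - 1)) s).mul
          (Gammaℝ_differentiableAt hp)) (differentiableAt_riemannZeta h1),
      logDeriv_mul (f := fun s => s * (s - 1)) (g := Gammaℝ) s (mul_ne_zero h0 hs1) hG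
        (by fun_prop) (Gammaℝ_differentiableAt hp),
      logDeriv_mul (f := fun s : ℂ => s) (g := fun s => s - 1) s h0 hs1 (by fun_prop) (by fun_prop)]
    simp [logDeriv_apply]
  rw [hl, logDeriv_Gammaℝ hp]
  have e : 1 / s + 1 / (s - 1) + (-(Real.log Real.pi : ℂ) / 2 + Complex.digamma (s / 2) / 2)
      + logDeriv riemannZeta s - Complex.digamma (s / 2) / 2
      = 1 / s + 1 / (s - 1) + -(Real.log Real.pi : ℂ) / 2 + logDeriv riemannZeta s := by ring
  rw [e]
  have hn1 : 1 ≤ ‖s‖ := by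
    have := (le_abs_self _).trans (Complex.abs_re_le_norm s)
    linarith
  have hn2 : 1 ≤ ‖s - 1‖ := by
    have := (le_abs_self _).trans (Complex.abs_re_le_norm (s - 1))
    simp only [sub_re, one_re] at this
    linarith
  refine (norm_add_le _ _).trans (add_le_add ((norm_add_le _ _).trans
    (add_le_add_left ((norm_add_le _ _).trans ?_) _)) (h s hs))
  rw [norm_div, norm_div, norm_one]
  have := (div_le_one (by linarith)).2 hn1
  have := (div_le_one (by linarith)).2 hn2
  linarith

theorem logDeriv_riemannXi_one_sub (s : ℂ) :
    logDeriv riemannXi (1 - s) = -logDeriv riemannXi s := by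
  have h : (fun w => riemannXi (1 - w)) = riemannXi := funext riemannXi_one_sub
  have h2 : deriv riemannXi s = -deriv riemannXi (1 - s) := by
    conv_lhs => rw [← h]
    exact deriv_comp_const_sub _ _ _
  rw [logDeriv_apply, logDeriv_apply, riemannXi_one_sub, h2]
  ring

theorem digamma_conj (s : ℂ) :
    Complex.digamma ((starRingEnd ℂ) s) = (starRingEnd ℂ) (Complex.digamma s) := by
  have h : (starRingEnd ℂ) ∘ Complex.Gamma ∘ (starRingEnd ℂ) = Complex.Gamma := by
    funext w
    simp [Complex.Gamma_conj]
  have h2 : deriv Complex.Gamma ((starRingEnd ℂ) s) = (starRingEnd ℂ) (deriv Complex.Gamma s) := by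
    have := congrFun (deriv_conj_conj (𝕜 := ℂ) (f := Complex.Gamma)) ((starRingEnd ℂ) s)
    rw [h] at this
    simpa using this
  rw [Complex.digamma_def, logDeriv_apply, logDeriv_apply, Complex.Gamma_conj, h2, map_div₀]

theorem differentiableOn_logDeriv_riemannXi :
    DifferentiableOn ℂ (logDeriv riemannXi) {s | riemannXi s ≠ 0} :=
  (((differentiable_riemannXi.contDiff (n := 2)).differentiable_deriv_two).differentiableOn).div
    differentiable_riemannXi.differentiableOn fun _ hs => hs

theorem exists_norm_integral_digamma_half_le {ℓ t₀ : ℝ} (hℓ : ℓ ≠ 0) :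
    ∃ C, 0 ≤ C ∧ ∀ U, 2 ≤ U → t₀ ≤ U →
      ‖∫ y : ℝ in t₀..U, Complex.digamma (3 + (y / 2 : ℝ) * I) * Complex.exp (y * I * ℓ)‖
        ≤ C * (U + |t₀|) := by
  obtain ⟨C, hC, h⟩ := exists_norm_integral_digamma_mul_exp_le (ℓ := 2 * ℓ) (u₀ := t₀ / 2)
    (by simpa using hℓ)
  refine ⟨C, hC, fun U hU hU0 => ?_⟩
  have e := intervalIntegral.integral_comp_div (a := t₀) (b := U)
    (fun u : ℝ => Complex.digamma (3 + u * I) * Complex.exp (u * I * (2 * ℓ : ℝ))) two_ne_zero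
  have e2 : ∫ y : ℝ in t₀..U, Complex.digamma (3 + (y / 2 : ℝ) * I) * Complex.exp (y * I * ℓ)
      = ∫ y : ℝ in t₀..U, Complex.digamma (3 + (y / 2 : ℝ) * I)
          * Complex.exp ((y / 2 : ℝ) * I * (2 * ℓ : ℝ)) := by
    refine intervalIntegral.integral_congr fun y _ => ?_
    have : (y * I * ℓ : ℂ) = (y / 2 : ℝ) * I * (2 * ℓ : ℝ) := by push_cast; ring
    simp only [this]
  rw [e2, e, norm_smul]
  have h1 := h (U / 2) (by linarith) (by linarith)
  have h2 : |t₀ / 2| = |t₀| / 2 := by rw [abs_div]; norm_num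
  rw [h2] at h1
  calc _ ≤ ‖(2 : ℝ)‖ * (C * (U / 2 + |t₀| / 2)) := by gcongr
    _ = _ := by norm_num; ring

theorem norm_exp_mul_I_mul (y ℓ : ℝ) : ‖Complex.exp (y * I * ℓ)‖ = 1 := by
  have : (y * I * ℓ : ℂ) = ((y * ℓ : ℝ) : ℂ) * I := by push_cast; ring
  rw [this, Complex.norm_exp_ofReal_mul_I]

theorem continuous_logDeriv_riemannXi_six (k : ℝ) :
    Continuous fun y : ℝ => logDeriv riemannXi (6 + (k * y : ℝ) * I) :=
  differentiableOn_logDeriv_riemannXi.continuousOn.comp_continuous (by fun_prop) fun y =>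
    riemannXi_ne_zero_of_one_le_re (by simp)

theorem continuous_digamma_three (k : ℝ) :
    Continuous fun y : ℝ => Complex.digamma (3 + (k * y / 2 : ℝ) * I) :=
  differentiableOn_digamma.continuousOn.comp_continuous (by fun_prop) fun y => by simp

theorem exists_norm_integral_logDeriv_riemannXi_sub_le (t₀ ℓ : ℝ) :
    ∃ M, 0 ≤ M ∧ ∀ k : ℝ, ∀ U, t₀ ≤ U →
      ‖(∫ y : ℝ in t₀..U, logDeriv riemannXi (6 + (k * y : ℝ) * I) * Complex.exp (y * I * ℓ))
        - (∫ y : ℝ in t₀..U, Complex.digamma (3 + (k * y / 2 : ℝ) * I)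
            * Complex.exp (y * I * ℓ)) / 2‖ ≤ M * (U + |t₀|) := by
  obtain ⟨M, hM, h⟩ := exists_norm_logDeriv_riemannXi_sub_digamma_le
  refine ⟨M, hM, fun k U hU => ?_⟩
  have i1 : Continuous fun y : ℝ =>
      logDeriv riemannXi (6 + (k * y : ℝ) * I) * Complex.exp (y * I * ℓ) :=
    (continuous_logDeriv_riemannXi_six k).mul (by fun_prop)
  have i2 : Continuous fun y : ℝ =>
      Complex.digamma (3 + (k * y / 2 : ℝ) * I) * Complex.exp (y * I * ℓ) / 2 :=
    ((continuous_digamma_three k).mul (by fun_prop)).div_const 2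
  rw [← intervalIntegral.integral_div, ← intervalIntegral.integral_sub
    (i1.intervalIntegrable _ _) (i2.intervalIntegrable _ _)]
  have hb : ∀ y : ℝ, ‖logDeriv riemannXi (6 + (k * y : ℝ) * I) * Complex.exp (y * I * ℓ)
      - Complex.digamma (3 + (k * y / 2 : ℝ) * I) * Complex.exp (y * I * ℓ) / 2‖ ≤ M := by
    intro y
    have h1 := h (6 + (k * y : ℝ) * I) (by simp)
    have e : ((6 : ℂ) + (k * y : ℝ) * I) / 2 = 3 + (k * y / 2 : ℝ) * I := by push_cast; ring
    rw [e] at h1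
    have e2 : ∀ a b c : ℂ, a * b - c * b / 2 = (a - c / 2) * b := fun a b c => by ring
    rwa [e2, norm_mul, norm_exp_mul_I_mul, mul_one]
  refine (intervalIntegral.norm_integral_le_of_norm_le_const fun y _ => hb y).trans ?_
  rw [abs_of_nonneg (by linarith)]
  have := neg_abs_le t₀
  gcongr
  linarith

theorem exists_norm_integral_right_le {ℓ t₀ : ℝ} (hℓ : ℓ ≠ 0) :
    ∃ C, 0 ≤ C ∧ ∀ U, 2 ≤ U → t₀ ≤ U →
      ‖∫ y : ℝ in t₀..U, Complex.exp (((6 : ℝ) + y * I) * ℓ)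
        * logDeriv riemannXi ((6 : ℝ) + y * I)‖ ≤ C * (U + |t₀|) := by
  obtain ⟨C, hC, h⟩ := exists_norm_integral_digamma_half_le (t₀ := t₀) hℓ
  obtain ⟨M, hM, h'⟩ := exists_norm_integral_logDeriv_riemannXi_sub_le t₀ ℓ
  refine ⟨Real.exp (6 * ℓ) * (M + C / 2), by positivity, fun U hU hU0 => ?_⟩
  have h1 := h U hU hU0
  have h2 := h' 1 U hU0
  simp only [one_mul] at h2
  have e : ∫ y : ℝ in t₀..U, Complex.exp (((6 : ℝ) + y * I) * ℓ)
        * logDeriv riemannXi ((6 : ℝ) + y * I)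
      = Complex.exp ((6 * ℓ : ℝ)) * ∫ y : ℝ in t₀..U, logDeriv riemannXi (6 + (y : ℝ) * I)
        * Complex.exp (y * I * ℓ) := by
    rw [← intervalIntegral.integral_const_mul]
    refine intervalIntegral.integral_congr fun y _ => ?_
    have : (((6 : ℝ) + y * I) * ℓ : ℂ) = (6 * ℓ : ℝ) + y * I * ℓ := by push_cast; ring
    simp only [this, Complex.exp_add]
    push_cast
    ring
  rw [e, norm_mul, ← Complex.ofReal_exp, Complex.norm_real, Real.norm_eq_abs, Real.abs_exp,
    mul_assoc]
  gcongr
  have h3 := norm_sub_norm_le (∫ y : ℝ in t₀..U, logDeriv riemannXi (6 + (y : ℝ) * I)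
        * Complex.exp (y * I * ℓ)) ((∫ y : ℝ in t₀..U, Complex.digamma (3 + (y / 2 : ℝ) * I)
            * Complex.exp (y * I * ℓ)) / 2)
  rw [norm_div, Complex.norm_ofNat] at h3
  linarith

theorem exists_norm_integral_left_le {ℓ t₀ : ℝ} (hℓ : ℓ ≠ 0) :
    ∃ C, 0 ≤ C ∧ ∀ U, 2 ≤ U → t₀ ≤ U →
      ‖∫ y : ℝ in t₀..U, Complex.exp (((-5 : ℝ) + y * I) * ℓ)
        * logDeriv riemannXi ((-5 : ℝ) + y * I)‖ ≤ C * (U + |t₀|) := by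
  obtain ⟨C, hC, h⟩ := exists_norm_integral_digamma_half_le (t₀ := t₀) (neg_ne_zero.2 hℓ)
  obtain ⟨M, hM, h'⟩ := exists_norm_integral_logDeriv_riemannXi_sub_le t₀ ℓ
  refine ⟨Real.exp (-5 * ℓ) * (M + C / 2), by positivity, fun U hU hU0 => ?_⟩
  have h1 := h U hU hU0
  have h2 := h' (-1) U hU0
  have hconj : ∫ y : ℝ in t₀..U, Complex.digamma (3 + (-1 * y / 2 : ℝ) * I)
      * Complex.exp (y * I * ℓ)
      = (starRingEnd ℂ) (∫ y : ℝ in t₀..U, Complex.digamma (3 + (y / 2 : ℝ) * I)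
        * Complex.exp (y * I * (-ℓ : ℝ))) := by
    rw [← intervalIntegral.intervalIntegral_conj]
    refine intervalIntegral.integral_congr fun y _ => ?_
    have a1 : (starRingEnd ℂ) (3 + (y / 2 : ℝ) * I) = 3 + (-1 * y / 2 : ℝ) * I := by
      rw [map_add, map_mul, Complex.conj_ofReal, Complex.conj_I, map_ofNat]
      push_cast
      ring
    have a2 : (starRingEnd ℂ) (y * I * (-ℓ : ℝ)) = y * I * ℓ := by
      apply Complex.ext <;> simp
    simp only [map_mul (starRingEnd ℂ) (Complex.digamma _), ← digamma_conj, ← Complex.exp_conj,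
      a1, a2]
  rw [hconj] at h2
  have e : ∫ y : ℝ in t₀..U, Complex.exp (((-5 : ℝ) + y * I) * ℓ)
        * logDeriv riemannXi ((-5 : ℝ) + y * I)
      = -(Complex.exp ((-5 * ℓ : ℝ)) * ∫ y : ℝ in t₀..U,
        logDeriv riemannXi (6 + (-1 * y : ℝ) * I) * Complex.exp (y * I * ℓ)) := by
    rw [← intervalIntegral.integral_const_mul, ← intervalIntegral.integral_neg]
    refine intervalIntegral.integral_congr fun y _ => ?_
    have e1 : (((-5 : ℝ) + y * I) * ℓ : ℂ) = (-5 * ℓ : ℝ) + y * I * ℓ := by push_cast; ring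
    have e2 : ((-5 : ℝ) + y * I : ℂ) = 1 - (6 + (-1 * y : ℝ) * I) := by push_cast; ring
    simp only [e1, Complex.exp_add]
    rw [e2, logDeriv_riemannXi_one_sub]
    ring
  rw [e, norm_neg, norm_mul, ← Complex.ofReal_exp, Complex.norm_real, Real.norm_eq_abs,
    Real.abs_exp, mul_assoc]
  gcongr
  have h3 := norm_sub_norm_le (∫ y : ℝ in t₀..U, logDeriv riemannXi (6 + (-1 * y : ℝ) * I)
        * Complex.exp (y * I * ℓ)) ((starRingEnd ℂ) (∫ y : ℝ in t₀..U,
          Complex.digamma (3 + (y / 2 : ℝ) * I) * Complex.exp (y * I * (-ℓ : ℝ))) / 2)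
  rw [norm_div, Complex.norm_ofNat, RCLike.norm_conj] at h3
  linarith

theorem Set.Finite.exists_gap_above {Z : Set ℂ} (hZ : Z.Finite) {a b : ℝ} (hab : a < b) :
    ∃ t, a < t ∧ t < b ∧ ∀ ρ ∈ Z, ρ.im ≤ a ∨ t < ρ.im := by
  have h1 : ∀ᶠ t in nhdsWithin a (Set.Ioi a), ∀ ρ ∈ Z, ρ.im ≤ a ∨ t < ρ.im := by
    rw [Filter.eventually_all_finite hZ]
    intro ρ _
    rcases le_or_gt ρ.im a with h | h
    · exact Filter.Eventually.of_forall fun _ => Or.inl h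
    · filter_upwards [Ioo_mem_nhdsGT h] with t ht using Or.inr ht.2
  obtain ⟨t, ht, ht'⟩ := (h1.and (Ioo_mem_nhdsGT hab)).exists
  exact ⟨t, ht'.1, ht'.2, ht⟩

theorem exists_riemannXi_zero_gap (a : ℝ) {b : ℝ} (hab : a < b) :
    ∃ t, a < t ∧ t < b ∧ ∀ ρ, riemannXi ρ = 0 → ρ.im ≤ a ∨ t < ρ.im := by
  have hfin := finite_zeros_of_entire differentiable_riemannXi
    (riemannXi_ne_zero_of_one_le_re (s := 1) (by simp))
    ((isCompact_Icc (a := (0 : ℝ)) (b := 1)).reProdIm (isCompact_Icc (a := a) (b := b)))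
  obtain ⟨t, h1, h2, h3⟩ := hfin.exists_gap_above hab
  refine ⟨t, h1, h2, fun ρ hρ => ?_⟩
  obtain ⟨-, hr0, hr1⟩ := riemannXi_eq_zero_iff.1 hρ
  by_contra! hcon
  have := h3 ρ ⟨⟨⟨hr0.le, hr1.le⟩, ⟨hcon.1.le, hcon.2.trans h2.le⟩⟩, hρ⟩
  rcases this with h | h <;> linarith [hcon.1, hcon.2]

theorem exists_norm_integral_top_le (ℓ : ℝ) :
    ∃ C, 0 ≤ C ∧ ∀ T, 2 ≤ T → (∀ ρ, riemannXi ρ = 0 → ρ.im ≠ T) →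
      ‖∫ σ : ℝ in (-5 : ℝ)..6, Complex.exp ((σ + T * I) * ℓ) * logDeriv riemannXi (σ + T * I)‖
        ≤ C * T := by
  obtain ⟨A, hA, hA'⟩ := exists_norm_riemannXi_le_exp_mul
  set B := Real.exp (6 * |ℓ|) * (11 * |ℓ| + 2 * (20 + Real.pi)) with hB
  have hB0 : 0 ≤ B := by positivity
  have hlog : 0 < Real.log 2 := Real.log_pos one_lt_two
  refine ⟨A / Real.log 2 * B + Real.exp (6 * |ℓ|) * (96 * A) * 11, by positivity,
    fun T hT hne => ?_⟩
  have hT0 : 0 < T := by linarith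
  obtain ⟨S, m, g, hg, hS0, hSb, hfg, hg0, hm, hgb⟩ := exists_local_factorization
    (f := riemannXi) (c := 6 + T * I) (r := 11) (R := 12) (L := A * T) differentiable_riemannXi
    (by norm_num) (by norm_num) (by positivity)
    (riemannXi_ne_zero_of_one_le_re (by simp)) (by
      have := hA' T hT
      norm_num at this ⊢
      exact this)
  have hmem : ∀ σ ∈ Set.Icc (-5 : ℝ) 6, (σ + T * I : ℂ) ∈ Metric.closedBall (6 + T * I : ℂ) 11 := by
    intro σ hσ
    rw [Metric.mem_closedBall, dist_eq_norm,
      show (σ + T * I - (6 + T * I) : ℂ) = ((σ - 6 : ℝ) : ℂ) by push_cast; ring,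
      Complex.norm_real, Real.norm_eq_abs, abs_le]
    constructor <;> linarith [hσ.1, hσ.2]
  have hnz : ∀ ρ ∈ S, ∀ σ : ℝ, (σ + T * I - ρ : ℂ) ≠ 0 := fun ρ hρ σ h => by
    have := congrArg Complex.im h
    simp at this
    exact hne ρ (hS0 ρ hρ) (by linarith)
  have hgn : ∀ σ ∈ Set.Icc (-5 : ℝ) 6, g (σ + T * I) ≠ 0 := fun σ hσ =>
    hg0 _ (Metric.closedBall_subset_closedBall (by norm_num) (hmem σ hσ))
  have hI1 : ∀ ρ ∈ S, IntervalIntegrable (fun σ : ℝ =>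
      (m ρ : ℂ) * (Complex.exp ((σ + T * I) * ℓ) / (σ + T * I - ρ)))
      MeasureTheory.volume (-5) 6 := by
    intro ρ hρ
    refine Continuous.intervalIntegrable ?_ _ _
    exact continuous_const.mul (Continuous.div (by fun_prop) (by fun_prop) (hnz ρ hρ))
  have hI2 : IntervalIntegrable (fun σ : ℝ =>
      Complex.exp ((σ + T * I) * ℓ) * logDeriv g (σ + T * I)) MeasureTheory.volume (-5) 6 := by
    refine ContinuousOn.intervalIntegrable ?_
    rw [Set.uIcc_of_le (by norm_num)]
    refine ContinuousOn.mul (by fun_prop) ?_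
    have hd : Continuous (deriv g) :=
      ((hg.contDiff (n := 2)).differentiable_deriv_two).continuous
    exact ContinuousOn.div
      (hd.comp (by fun_prop : Continuous fun σ : ℝ => (σ + T * I : ℂ))).continuousOn
      (hg.continuous.comp (by fun_prop : Continuous fun σ : ℝ => (σ + T * I : ℂ))).continuousOn hgn
  have key : ∫ σ : ℝ in (-5 : ℝ)..6, Complex.exp ((σ + T * I) * ℓ) * logDeriv riemannXi (σ + T * I)
      = (∑ ρ ∈ S, (m ρ : ℂ) * ∫ σ : ℝ in (-5 : ℝ)..6,
          Complex.exp ((σ + T * I) * ℓ) / (σ + T * I - ρ))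
        + ∫ σ : ℝ in (-5 : ℝ)..6, Complex.exp ((σ + T * I) * ℓ) * logDeriv g (σ + T * I) := by
    simp_rw [← intervalIntegral.integral_const_mul]
    rw [← intervalIntegral.integral_finsetSum hI1, ← intervalIntegral.integral_add
      (by simpa [Finset.sum_fn] using IntervalIntegrable.sum S hI1) hI2]
    refine intervalIntegral.integral_congr fun σ hσ => ?_
    rw [Set.uIcc_of_le (by norm_num)] at hσ
    rw [logDeriv_eq_sum_add_logDeriv hg S m hfg (fun ρ hρ => hnz ρ hρ σ) (hgn σ hσ), mul_add,
      Finset.mul_sum]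
    congr 1
    refine Finset.sum_congr rfl fun ρ _ => ?_
    ring
  have h1 : ‖∑ ρ ∈ S, (m ρ : ℂ) * ∫ σ : ℝ in (-5 : ℝ)..6,
      Complex.exp ((σ + T * I) * ℓ) / (σ + T * I - ρ)‖ ≤ A * T / Real.log 2 * B := by
    calc _ ≤ ∑ ρ ∈ S, (m ρ : ℝ) * B := by
          refine norm_sum_le_of_le _ fun ρ hρ => ?_
          rw [norm_mul, Complex.norm_natCast]
          obtain ⟨-, hr0, hr1⟩ := riemannXi_eq_zero_iff.1 (hS0 ρ hρ)
          refine mul_le_mul_of_nonneg_left (norm_integral_exp_div_sub_le ℓ T hr0.le hr1.le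
            (hne ρ (hS0 ρ hρ)) ?_) (Nat.cast_nonneg _)
          have h2 := (Complex.abs_im_le_norm _).trans (mem_closedBall_iff_norm.1 (hSb ρ hρ))
          rw [abs_sub_comm]
          simpa using h2
      _ = (∑ ρ ∈ S, (m ρ : ℝ)) * B := by rw [Finset.sum_mul]
      _ ≤ _ := by gcongr
  have h2 : ‖∫ σ : ℝ in (-5 : ℝ)..6, Complex.exp ((σ + T * I) * ℓ) * logDeriv g (σ + T * I)‖
      ≤ Real.exp (6 * |ℓ|) * (96 * (A * T)) * |6 - (-5)| := by
    refine intervalIntegral.norm_integral_le_of_norm_le_const fun σ hσ => ?_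
    rw [Set.uIoc_of_le (by norm_num)] at hσ
    rw [norm_mul]
    have e1 := norm_exp_mul_ofReal_le (B := 6) (s := σ + T * I) ℓ (by
      simp only [add_re, ofReal_re, mul_re, I_re, mul_zero, ofReal_im, I_im, mul_one, sub_self,
        add_zero]
      rw [abs_le]
      constructor <;> linarith [hσ.1, hσ.2])
    have e2 := hgb _ (hmem σ ⟨hσ.1.le, hσ.2⟩)
    norm_num at e2
    gcongr
  rw [key]
  refine (norm_add_le _ _).trans ((add_le_add h1 h2).trans (le_of_eq ?_))
  norm_num
  ring

/-- The sum of `exp (ρ ℓ)` over the zeros of `riemannXi` of bounded positive height, with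
multiplicities, as a boundary integral. -/
theorem rectIntegral_exp_mul_logDeriv_riemannXi (ℓ : ℝ) {c T d : ℝ} (hcd : c ≤ d) (hc0 : 0 < c)
    (hTd : T < d) (hc : ∀ ρ, riemannXi ρ = 0 → ρ.im ≤ 0 ∨ c < ρ.im)
    (hd : ∀ ρ, riemannXi ρ = 0 → ρ.im ≤ T ∨ d < ρ.im) (S : Finset ℂ) (m : ℂ → ℕ)
    (hS : ∀ ρ, ρ ∈ S ↔ riemannXi ρ = 0 ∧ 0 < ρ.im ∧ ρ.im ≤ T)
    (hm : ∀ ρ ∈ S, ∃ g : ℂ → ℂ, AnalyticAt ℂ g ρ ∧ g ρ ≠ 0 ∧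
      ∀ᶠ w in nhds ρ, riemannXi w = (w - ρ) ^ m ρ * g w) :
    rectIntegral (fun s => Complex.exp (s * ℓ) * logDeriv riemannXi s) (-5) 6 c d
      = 2 * Real.pi * I * ∑ ρ ∈ S, (m ρ : ℂ) * Complex.exp (ρ * ℓ) := by
  obtain ⟨g, hg, hgS, hfg⟩ := exists_entire_factor S m differentiable_riemannXi hm
  refine rectIntegral_mul_logDeriv (F := fun s => Complex.exp (s * ℓ)) (by norm_num) hcd
    (by fun_prop) hg S m (fun ρ hρ => ?_) hfg fun s hs h0 => ?_
  · obtain ⟨h0, h1, h2⟩ := (hS ρ).1 hρ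
    obtain ⟨-, hr0, hr1⟩ := riemannXi_eq_zero_iff.1 h0
    refine ⟨by linarith, by linarith, ?_, by linarith⟩
    exact (hc ρ h0).resolve_left h1.not_ge
  · have hx : riemannXi s = 0 := by rw [hfg, h0, mul_zero]
    have hs2 : s.im ∈ Set.Icc c d := hs.2
    refine hgS s ((hS s).2 ⟨hx, hc0.trans_le hs2.1, ?_⟩) h0
    exact (hd s hx).resolve_right hs2.2.not_gt

theorem exists_norm_sum_exp_le {ℓ : ℝ} (hℓ : ℓ ≠ 0) :
    ∃ C : ℝ, ∀ T : ℝ, 2 ≤ T → ∀ (S : Finset ℂ) (m : ℂ → ℕ),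
      (∀ ρ, ρ ∈ S ↔ riemannXi ρ = 0 ∧ 0 < ρ.im ∧ ρ.im ≤ T) →
      (∀ ρ ∈ S, ∃ g : ℂ → ℂ, AnalyticAt ℂ g ρ ∧ g ρ ≠ 0 ∧
        ∀ᶠ w in nhds ρ, riemannXi w = (w - ρ) ^ m ρ * g w) →
      ‖∑ ρ ∈ S, (m ρ : ℂ) * Complex.exp (ρ * ℓ)‖ ≤ C * T := by
  obtain ⟨c, hc0, hc1, hc⟩ := exists_riemannXi_zero_gap 0 one_pos
  obtain ⟨C₁, hC₁, h₁⟩ := exists_norm_integral_top_le ℓ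
  obtain ⟨C₂, hC₂, h₂⟩ := exists_norm_integral_right_le (t₀ := c) hℓ
  obtain ⟨C₃, hC₃, h₃⟩ := exists_norm_integral_left_le (t₀ := c) hℓ
  set D := ‖∫ σ : ℝ in (-5 : ℝ)..6, Complex.exp ((σ + c * I) * ℓ)
    * logDeriv riemannXi (σ + c * I)‖ with hD
  refine ⟨(D + 2 * C₁ + 3 * C₂ + 3 * C₃) / (2 * Real.pi), fun T hT S m hS hm => ?_⟩
  obtain ⟨d, hTd, hdT, hd⟩ := exists_riemannXi_zero_gap T (lt_add_one T)
  have key := rectIntegral_exp_mul_logDeriv_riemannXi ℓ (by linarith) hc0 hTd hc hd S m hS hm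
  have b1 := h₁ d (by linarith) fun ρ hρ h => by
    rcases hd ρ hρ with h' | h' <;> linarith
  have b2 := h₂ d (by linarith) (by linarith)
  have b3 := h₃ d (by linarith) (by linarith)
  rw [abs_of_pos hc0] at b2 b3
  have hnorm : ‖(2 * Real.pi * I : ℂ)‖ = 2 * Real.pi := by
    simp [abs_of_pos Real.pi_pos]
  have hle : 2 * Real.pi * ‖∑ ρ ∈ S, (m ρ : ℂ) * Complex.exp (ρ * ℓ)‖
      ≤ D + C₁ * d + C₂ * (d + c) + C₃ * (d + c) := by
    rw [← hnorm, ← norm_mul, ← key, rectIntegral]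
    refine (norm_sub_le _ _).trans (add_le_add ((norm_add_le _ _).trans (add_le_add
      ((norm_sub_le _ _).trans (add_le_add ?_ b1)) ?_)) ?_)
    · rw [hD]
    · rw [norm_mul, norm_I, one_mul]; exact b2
    · rw [norm_mul, norm_I, one_mul]; exact b3
  rw [div_mul_eq_mul_div, le_div_iff₀ (by positivity), mul_comm]
  refine hle.trans ?_
  have hD0 : 0 ≤ D := norm_nonneg _
  have d1 : D ≤ D * T := le_mul_of_one_le_right hD0 (by linarith)
  have d2 : C₁ * d ≤ C₁ * (2 * T) := by gcongr; linarith
  have d3 : C₂ * (d + c) ≤ C₂ * (3 * T) := by gcongr; linarith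
  have d4 : C₃ * (d + c) ≤ C₃ * (3 * T) := by gcongr; linarith
  linarith

/-- consequence of Landau's formula.
If `x > 0` and `x ≠ 1`, there is a constant `C` such that for all `T ≥ 2`,
`|Σ_ρ x^ρ| ≤ C·T`, the sum running over the nontrivial zeros `ρ` of `ζ` with
`0 < Im ρ ≤ T`, each counted according to its multiplicity (the order of
vanishing of `ζ` at `ρ`), and `x^ρ = exp(ρ log x)`.  The finite set of such
zeros is encoded by a `Finset S`, and the multiplicity of each `ρ ∈ S` by a
function `m` required to satisfy the defining property of the order of
vanishing. -/
theorem stmt_6 (x : ℝ) (hx : 0 < x) (hx1 : x ≠ 1) :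
    ∃ C : ℝ, ∀ T : ℝ, 2 ≤ T → ∀ (S : Finset ℂ) (m : ℂ → ℕ),
      (∀ ρ : ℂ, ρ ∈ S ↔ (riemannZeta ρ = 0 ∧ 0 < ρ.re ∧ ρ.re < 1 ∧ 0 < ρ.im ∧ ρ.im ≤ T)) →
      (∀ ρ ∈ S, ∃ g : ℂ → ℂ, AnalyticAt ℂ g ρ ∧ g ρ ≠ 0 ∧
        ∀ᶠ w in nhds ρ, riemannZeta w = (w - ρ) ^ (m ρ) * g w) →
      ‖∑ ρ ∈ S, (m ρ : ℂ) * Complex.exp (ρ * Real.log x)‖ ≤ C * T := by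
  obtain ⟨C, hC⟩ := exists_norm_sum_exp_le (Real.log_ne_zero_of_pos_of_ne_one hx hx1)
  refine ⟨C, fun T hT S m hS hm => hC T hT S m (fun ρ => ?_) fun ρ hρ => ?_⟩
  · rw [hS, riemannXi_eq_zero_iff]
    tauto
  · obtain ⟨-, h0, h1, -⟩ := (hS ρ).1 hρ
    exact riemannXi_local_factorization h0 h1 (hm ρ hρ)
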